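/- arXiv:2010.00701 — 3 statements merged into one kernel-verified Lean document; each statement's English description precedes it below -/
import Mathlib

section
/- Every r-disk family (on a circle of any circumference) has area at least (3/2)·r². -/
noncomputable section

/-- An arc of the circle `ℝ/cℤ`: the image of a closed interval `[a, b] ⊆ ℝ` with
`0 < b - a < c`. -/
structure Arc (c : ℝ) where
  /-- initial representative -/
  a : ℝ
  /-- terminal representative -/
  b : ℝ
  width_pos : 0 < b - a
  width_lt : b - a < c

namespace Arc

variable {c : ℝ}

/-- The underlying subset of the circle `ℝ/cℤ`. -/
def toSet (α : Arc c) : Set (AddCircle c) :=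
  (fun x : ℝ => (x : AddCircle c)) '' Set.Icc α.a α.b

/-- The interior of an arc: the image of the open interval `(a, b)`. -/
def interiorSet (α : Arc c) : Set (AddCircle c) :=
  (fun x : ℝ => (x : AddCircle c)) '' Set.Ioo α.a α.b

/-- The width `b - a` of an arc. -/
def width (α : Arc c) : ℝ := α.b - α.a

/-- The initial endpoint of an arc. -/
def init (α : Arc c) : AddCircle c := (α.a : AddCircle c)

/-- The terminal endpoint of an arc. -/
def term (α : Arc c) : AddCircle c := (α.b : AddCircle c)

/-- The two endpoints of an arc. -/
def endpoints (α : Arc c) : Set (AddCircle c) := {α.init, α.term}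

/-- Two arcs are *adjacent* if they intersect in exactly one point, which is a common
endpoint. -/
def Adjacent (α β : Arc c) : Prop :=
  ∃ p, α.toSet ∩ β.toSet = {p} ∧ p ∈ α.endpoints ∧ p ∈ β.endpoints

/-- Two arcs *share an endpoint* if some endpoint of one is an endpoint of the other. -/
def SharesEndpoint (α β : Arc c) : Prop := (α.endpoints ∩ β.endpoints).Nonempty

/-- Two arcs with no common endpoint *cross* if exactly one of the two endpoints of one
of them lies in the other. -/
def Crosses (α β : Arc c) : Prop :=
  ¬ SharesEndpoint α β ∧
    (Xor' (β.init ∈ α.toSet) (β.term ∈ α.toSet) ∨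
      Xor' (α.init ∈ β.toSet) (α.term ∈ β.toSet))

end Arc

/-- A finite family of arcs of the circle `ℝ/cℤ` (of circumference `c > 0`) is an
*`r`-disk family* if:
(i) no two arcs of the family have union equal to the whole circle;
(ii) every point of the circle that is not an endpoint of any arc of the family lies in
exactly `r` arcs of the family;
(iii) every point of the circle that is an endpoint of some arc of the family is the
terminal endpoint of exactly one arc and the initial endpoint of exactly one arc of the
family, and these two arcs intersect only in that point. -/
def IsDiskFamily (r : ℕ) {c : ℝ} (I : Finset (Arc c)) : Prop :=
  0 < c ∧
  (∀ α ∈ I, ∀ β ∈ I, α.toSet ∪ β.toSet ≠ Set.univ) ∧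
  (∀ p : AddCircle c, (∀ α ∈ I, p ∉ α.endpoints) →
    Nat.card {α : Arc c // α ∈ I ∧ p ∈ α.toSet} = r) ∧
  (∀ p : AddCircle c, (∃ α ∈ I, p ∈ α.endpoints) →
    Nat.card {α : Arc c // α ∈ I ∧ α.term = p} = 1 ∧
    Nat.card {α : Arc c // α ∈ I ∧ α.init = p} = 1 ∧
    (∀ α ∈ I, ∀ β ∈ I, α.term = p → β.init = p → α.toSet ∩ β.toSet = {p}))

/-- The *area* of a family of arcs: the number of unordered pairs of arcs that cross,
plus one half of the number of unordered pairs of arcs that share an endpoint.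
(It is computed here from the corresponding counts of ordered pairs.) -/
def diskArea {c : ℝ} (I : Finset (Arc c)) : ℝ :=
  (Nat.card {p : Arc c × Arc c // p.1 ∈ I ∧ p.2 ∈ I ∧ p.1.Crosses p.2} : ℝ) / 2 +
    (Nat.card {p : Arc c × Arc c //
      p.1 ∈ I ∧ p.2 ∈ I ∧ p.1 ≠ p.2 ∧ p.1.SharesEndpoint p.2} : ℝ) / 4

/-- An `r`-disk family is *area-minimal* if no `r`-disk family (on a circle of any
circumference) has strictly smaller area. -/
def IsAreaMinimal (r : ℕ) {c : ℝ} (I : Finset (Arc c)) : Prop :=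
  IsDiskFamily r I ∧
    ∀ (c' : ℝ) (J : Finset (Arc c')), IsDiskFamily r J → diskArea I ≤ diskArea J

namespace CyclicFamily

/-- Indicator that the arc with start `a` and length `l` in `ℤ/q` covers the cell `x`. -/
def cov (q a l x : ℤ) : ℤ := if (x - a) % q < l then 1 else 0

/-- Twice the weight of the ordered pair of arcs `(a, l)`, `(a', l')` in `ℤ/q`: the second one
leaves the first one through its terminal endpoint, or starts there. -/
def wt (q a l a' l' : ℤ) : ℤ :=
  if 0 < (a' - a) % q ∧ (a' - a) % q < l ∧ l < (a' - a) % q + l' then 2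
  else if (a' - a) % q = l then 1 else 0

/-- Indicator that the position `a` is the position `g` of `ℤ/q`. -/
def atPos (q g a : ℤ) : ℤ := if (a - g) % q = 0 then 1 else 0

variable {ι : Type*}

/-- Twice the total weight of a family of arcs in `ℤ/q`. -/
def weight (q : ℤ) (s : Finset ι) (a l : ι → ℤ) : ℤ :=
  ∑ i ∈ s, ∑ j ∈ s, wt q (a i) (l i) (a j) (l j)

/-- A finite family of arcs in `ℤ/q` covering every cell exactly `r` times, no two of
which cover everything. -/
structure IsFamily (q r : ℤ) (s : Finset ι) (a l : ι → ℤ) : Prop where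
  pos : 0 < q
  len_pos : ∀ i ∈ s, 0 < l i
  sum_cov : ∀ x, ∑ i ∈ s, cov q (a i) (l i) x = r
  exists_not_cov : ∀ i ∈ s, ∀ j ∈ s, ∃ x, l i ≤ (x - a i) % q ∧ l j ≤ (x - a j) % q

theorem emod_eq_of_range {x q t k : ℤ} (h0 : 0 ≤ t) (h1 : t < q) (h : x = t + q * k) :
    x % q = t := by
  subst h
  rw [Int.add_mul_emod_self_left, Int.emod_eq_of_lt h0 h1]

theorem emod_add_cases {q : ℤ} (hq : 0 < q) (x y : ℤ) :
    ((x + y) % q = x % q + y % q ∧ x % q + y % q < q) ∨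
      ((x + y) % q = x % q + y % q - q ∧ q ≤ x % q + y % q) := by
  have hx := Int.emod_nonneg x hq.ne'
  have hy := Int.emod_nonneg y hq.ne'
  have hx' := Int.emod_lt_of_pos x hq
  have hy' := Int.emod_lt_of_pos y hq
  have ex := Int.emod_add_mul_ediv x q
  have ey := Int.emod_add_mul_ediv y q
  rcases lt_or_ge (x % q + y % q) q with h | h
  · left
    exact ⟨emod_eq_of_range (k := x / q + y / q) (by omega) h (by linear_combination -ex - ey), h⟩
  · right
    exact ⟨emod_eq_of_range (k := x / q + y / q + 1) (by omega) (by omega)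
      (by linear_combination -ex - ey), h⟩

/-- The offset of `z` from `x` in terms of those of `y` from `x` and of `z` from `y`. -/
theorem emod_sub_cases {q : ℤ} (hq : 0 < q) (x y z : ℤ) :
    0 ≤ (y - x) % q ∧ (y - x) % q < q ∧ 0 ≤ (z - y) % q ∧ (z - y) % q < q ∧
    (((z - x) % q = (y - x) % q + (z - y) % q ∧ (y - x) % q + (z - y) % q < q) ∨
      ((z - x) % q = (y - x) % q + (z - y) % q - q ∧ q ≤ (y - x) % q + (z - y) % q)) := by
  refine ⟨Int.emod_nonneg _ hq.ne', Int.emod_lt_of_pos _ hq, Int.emod_nonneg _ hq.ne',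
    Int.emod_lt_of_pos _ hq, ?_⟩
  have := emod_add_cases hq (y - x) (z - y)
  rwa [show y - x + (z - y) = z - x by ring] at this

theorem emod_sub_self (q x : ℤ) : (x - x) % q = 0 := by simp

namespace IsFamily

variable {q r : ℤ} {s : Finset ι} {a l : ι → ℤ}

theorem not_cover (h : IsFamily q r s a l) {i j : ι} (hi : i ∈ s) (hj : j ∈ s) :
    ¬ ((a j - a i) % q ≤ l i ∧ q ≤ (a j - a i) % q + l j) := by
  rintro ⟨h1, h2⟩
  obtain ⟨x, hx, hy⟩ := h.exists_not_cov i hi j hj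
  have := emod_sub_cases h.pos (a i) (a j) x
  omega

theorem len_lt (h : IsFamily q r s a l) {i : ι} (hi : i ∈ s) : l i < q := by
  obtain ⟨x, hx, -⟩ := h.exists_not_cov i hi i hi
  have := Int.emod_lt_of_pos (x - a i) h.pos
  omega

end IsFamily

theorem cov_sub_cov {q a l : ℤ} (hq : 0 < q) (hl : 0 < l) (hlq : l < q) (g : ℤ) :
    cov q a l g - cov q a l (g - 1) = atPos q g a - atPos q g (a + l) := by
  have h1 := emod_sub_cases hq a (g - 1) g
  have e1 : (g - (g - 1)) % q = 1 :=
    emod_eq_of_range (k := 0) (by omega) (by omega) (by ring)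
  have h2 := emod_sub_cases hq g a g
  have h3 := emod_sub_cases hq g a (a + l)
  have e3 : (a + l - a) % q = l := emod_eq_of_range (k := 0) hl.le hlq (by ring)
  have h4 := emod_sub_self q g
  unfold cov atPos
  split_ifs <;> omega

/-- At every position of the circle as many arcs start as end. -/
theorem IsFamily.sum_start_eq_sum_end {q r : ℤ} {s : Finset ι} {a l : ι → ℤ}
    (h : IsFamily q r s a l) (g : ℤ) :
    ∑ i ∈ s, atPos q g (a i) = ∑ i ∈ s, atPos q g (a i + l i) := by
  have h1 := h.sum_cov g
  have h2 := h.sum_cov (g - 1)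
  rw [← sub_eq_zero, ← Finset.sum_sub_distrib]
  rw [Finset.sum_congr rfl (fun i hi => (cov_sub_cov h.pos (h.len_pos i hi) (h.len_lt hi) g).symm),
    Finset.sum_sub_distrib, h1, h2, sub_self]

/-! ### Collapsing a cell -/

/-- The start of an arc after collapsing the cell `g - 1`; the position `g` becomes `0`. -/
def collapseStart (q g a : ℤ) : ℤ := (a - g) % q

/-- The length of an arc after collapsing the cell `g - 1`. -/
def collapseLen (q g a l : ℤ) : ℤ := l - cov q a l (g - 1)

theorem cov_pred {q g a l : ℤ} (hq : 0 < q) :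
    cov q a l (g - 1) = if q - 1 - collapseStart q g a < l then 1 else 0 := by
  have h1 := emod_sub_cases hq a (g - 1) g
  have h2 := emod_sub_cases hq g a g
  have h4 := emod_sub_self q g
  unfold cov collapseStart
  rcases eq_or_lt_of_le (show 1 ≤ q from hq) with h | h
  · subst h
    simp
  · have e1 : (g - (g - 1)) % q = 1 :=
      emod_eq_of_range (k := 0) (by omega) (by omega) (by ring)
    congr 1
    apply propext
    omega

set_option maxHeartbeats 4000000 in
theorem wt_collapse_le {q g a l a' l' : ℤ} (hq : 2 ≤ q) (hl : 0 < l) (hlq : l < q) (hl' : 0 < l')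
    (hlq' : l' < q) (h1 : ¬ ((a' - a) % q ≤ l ∧ q ≤ (a' - a) % q + l'))
    (h2 : ¬ ((a - a') % q ≤ l' ∧ q ≤ (a - a') % q + l)) :
    (if 0 < collapseLen q g a l then if 0 < collapseLen q g a' l' then
      wt (q - 1) (collapseStart q g a) (collapseLen q g a l)
        (collapseStart q g a') (collapseLen q g a' l') else 0 else 0) ≤
    wt q a l a' l' + atPos q (g - 1) (a + l) * atPos q g a' - atPos q g (a + l) * atPos q (g - 1) a'
      + (1 - if 0 < collapseLen q g a l then 1 else 0) * (atPos q (g - 1) a' - atPos q g a')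
      + (1 - if 0 < collapseLen q g a' l' then 1 else 0) *
        (atPos q g (a + l) - atPos q (g - 1) (a + l)) := by
  have hq0 : 0 < q := by omega
  unfold collapseLen
  rw [cov_pred hq0, cov_pred hq0]
  have key : ∀ b, atPos q g b = (if collapseStart q g b = 0 then 1 else 0) ∧
      atPos q (g - 1) b = (if collapseStart q g b = q - 1 then 1 else 0) := by
    intro b
    have h1 := emod_sub_cases hq0 (g - 1) g b
    have e1 : (g - (g - 1)) % q = 1 :=
      emod_eq_of_range (k := 0) (by omega) (by omega) (by ring)
    unfold atPos collapseStart
    refine ⟨rfl, ?_⟩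
    congr 1
    apply propext
    omega
  rw [(key _).1, (key _).1, (key _).2, (key _).2]
  have e0 := emod_sub_self q a
  have e1 := emod_sub_cases hq0 g a a'
  have e2 := emod_sub_cases hq0 a a' a
  have e3 := emod_sub_cases hq0 g a (a + l)
  have e3' : (a + l - a) % q = l := emod_eq_of_range (k := 0) hl.le hlq (by ring)
  unfold wt
  have f0 : (collapseStart q g a' - collapseStart q g a) % (q - 1) =
      if collapseStart q g a' < collapseStart q g a then
        (if collapseStart q g a = q - 1 ∧ collapseStart q g a' = 0 then 0
          else collapseStart q g a' - collapseStart q g a + (q - 1))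
      else if collapseStart q g a = 0 ∧ collapseStart q g a' = q - 1 then 0
      else collapseStart q g a' - collapseStart q g a := by
    unfold collapseStart
    split_ifs
    · exact emod_eq_of_range (k := -1) (by omega) (by omega) (by linarith)
    · exact emod_eq_of_range (k := -1) (by omega) (by omega) (by linarith)
    · exact emod_eq_of_range (k := 1) (by omega) (by omega) (by linarith)
    · exact emod_eq_of_range (k := 0) (by omega) (by omega) (by linarith)
  rw [f0]
  unfold collapseStart
  generalize (a' - g) % q = B at *
  generalize (a - g) % q = A at *
  generalize (a + l - g) % q = C at *
  generalize (a' - a) % q = d at *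
  generalize (a - a') % q = d' at *
  generalize (a + l - a) % q = z at *
  generalize (a - a) % q = z at *
  clear key f0
  obtain ⟨-, -, -, -, e2⟩ := e2
  obtain ⟨p1, p2, p3, p4, e1⟩ := e1
  obtain ⟨-, -, -, -, e3⟩ := e3
  subst e0 e3'
  rcases e1 with ⟨rfl, e1⟩ | ⟨rfl, e1⟩ <;> rcases e2 with ⟨e2, -⟩ | ⟨e2, -⟩ <;>
  rcases e3 with ⟨rfl, e3⟩ | ⟨rfl, e3⟩ <;>
  repeat' (first | omega | split)

theorem cov_emod (q a l x : ℤ) : cov q a l (x % q) = cov q a l x := by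
  unfold cov
  rw [Int.emod_sub_emod]

theorem cov_collapse {q g a l y : ℤ} (hq : 2 ≤ q) (hy : 0 ≤ y) (hyq : y < q - 1) :
    cov (q - 1) (collapseStart q g a) (collapseLen q g a l) y = cov q a l (y + g) := by
  have hq0 : 0 < q := by omega
  unfold collapseLen
  rw [cov_pred hq0]
  have h1 := emod_sub_cases hq0 g a (y + g)
  have e1 : (y + g - g) % q = y := emod_eq_of_range (k := 0) (by omega) (by omega) (by ring)
  unfold cov collapseStart
  have e2 : (y - (a - g) % q) % (q - 1) = if y < (a - g) % q then y - (a - g) % q + (q - 1)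
      else y - (a - g) % q := by
    split_ifs
    · exact emod_eq_of_range (k := -1) (by omega) (by omega) (by linarith)
    · exact emod_eq_of_range (k := 0) (by omega) (by omega) (by linarith)
  rw [e2]
  congr 1
  apply propext
  split_ifs <;> omega

theorem cov_eq_zero_iff {q a l x : ℤ} : cov q a l x = 0 ↔ l ≤ (x - a) % q := by
  unfold cov
  split_ifs <;> simp <;> omega

theorem cov_nonneg (q a l x : ℤ) : 0 ≤ cov q a l x := by
  unfold cov
  split_ifs <;> simp

theorem cov_of_nonpos {q a l x : ℤ} (hq : 0 < q) (hl : l ≤ 0) : cov q a l x = 0 :=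
  cov_eq_zero_iff.2 (hl.trans (Int.emod_nonneg _ hq.ne'))

namespace IsFamily

variable {q r : ℤ} {s : Finset ι} {a l : ι → ℤ}

theorem two_le (h : IsFamily q r s a l) (hr : 0 < r) : 2 ≤ q := by
  have hs : s.Nonempty := by
    rw [Finset.nonempty_iff_ne_empty]
    rintro rfl
    have := h.sum_cov 0
    simp at this
    omega
  obtain ⟨i, hi⟩ := hs
  have := h.len_lt hi
  have := h.len_pos i hi
  omega

theorem collapse (h : IsFamily q r s a l) (hr : 0 < r) {g : ℤ}
    (hg : ∀ i ∈ s, ∀ j ∈ s, ∃ x, (x - (g - 1)) % q ≠ 0 ∧ l i ≤ (x - a i) % q ∧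
      l j ≤ (x - a j) % q) :
    IsFamily (q - 1) r (s.filter fun i => 0 < collapseLen q g (a i) (l i))
      (fun i => collapseStart q g (a i)) (fun i => collapseLen q g (a i) (l i)) := by
  have hq := h.two_le hr
  have hq0 := h.pos
  refine ⟨by omega, fun i hi => (Finset.mem_filter.1 hi).2, fun x => ?_, fun i hi j hj => ?_⟩
  · rw [Finset.sum_filter]
    rw [← h.sum_cov (x % (q - 1) + g)]
    refine Finset.sum_congr rfl fun i _ => ?_
    have hx0 := Int.emod_nonneg x (show q - 1 ≠ 0 by omega)
    have hx1 := Int.emod_lt_of_pos x (show 0 < q - 1 by omega)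
    rw [← cov_collapse hq hx0 hx1, cov_emod]
    split_ifs with hp
    · rfl
    · exact (cov_of_nonpos (by omega) (by omega)).symm
  · have hi' := (Finset.mem_filter.1 hi).1
    have hj' := (Finset.mem_filter.1 hj).1
    obtain ⟨x, hx, hxi, hxj⟩ := hg i hi' j hj'
    have h0 := emod_sub_cases hq0 (g - 1) g x
    have e1 : (g - (g - 1)) % q = 1 :=
      emod_eq_of_range (k := 0) (by omega) (by omega) (by ring)
    refine ⟨(x - g) % q, ?_⟩
    have key : ∀ k, l k ≤ (x - a k) % q → collapseLen q g (a k) (l k) ≤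
        ((x - g) % q - collapseStart q g (a k)) % (q - 1) := by
      intro k hxk
      rw [← cov_eq_zero_iff, cov_collapse hq (by omega) (by omega),
        cov_eq_zero_iff, add_sub_assoc, Int.emod_add_emod]
      simpa using hxk
    exact ⟨key i hxi, key j hxj⟩

theorem weight_collapse_le (h : IsFamily q r s a l) (hr : 0 < r) (g : ℤ) :
    weight (q - 1) (s.filter fun i => 0 < collapseLen q g (a i) (l i))
      (fun i => collapseStart q g (a i)) (fun i => collapseLen q g (a i) (l i)) ≤
    weight q s a l := by
  have hq := h.two_le hr
  have b0 := h.sum_start_eq_sum_end g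
  have b1 := h.sum_start_eq_sum_end (g - 1)
  unfold weight
  rw [Finset.sum_filter]
  simp only [Finset.sum_filter]
  have step : ∀ i ∈ s, ∀ j ∈ s, _ := fun i hi j hj =>
    wt_collapse_le (g := g) hq (h.len_pos i hi) (h.len_lt hi) (h.len_pos j hj) (h.len_lt hj)
      (h.not_cover hi hj) (h.not_cover hj hi)
  calc _ = ∑ i ∈ s, ∑ j ∈ s, (if 0 < collapseLen q g (a i) (l i) then
        if 0 < collapseLen q g (a j) (l j) then
          wt (q - 1) (collapseStart q g (a i)) (collapseLen q g (a i) (l i))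
        (collapseStart q g (a j)) (collapseLen q g (a j) (l j)) else 0 else 0) := by
        refine Finset.sum_congr rfl fun i _ => ?_
        split_ifs <;> simp
    _ ≤ _ := Finset.sum_le_sum fun i hi => Finset.sum_le_sum fun j hj => step i hi j hj
    _ = _ := by
        simp only [Finset.sum_add_distrib, Finset.sum_sub_distrib]
        rw [← Finset.sum_mul_sum, ← Finset.sum_mul_sum, ← Finset.sum_mul_sum,
          Finset.sum_comm (f := fun i j => (1 - if 0 < collapseLen q g (a j) (l j) then (1 : ℤ)
            else 0) * _), ← Finset.sum_mul_sum, Finset.sum_sub_distrib, Finset.sum_sub_distrib,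
            Finset.sum_sub_distrib,
          b0, b1]
        ring

end IsFamily

/-! ### Families in which no cell can be collapsed -/

/-- The furthest that an arc of the family covering `x` extends beyond `x`. -/
def reach (q : ℤ) (s : Finset ι) (a l : ι → ℤ) (x : ℤ) : ℤ :=
  ((s.sup fun i => (l i - (x - a i) % q).toNat : ℕ) : ℤ)

theorem le_reach {q : ℤ} {s : Finset ι} {a l : ι → ℤ} {i : ι} (hi : i ∈ s) (x : ℤ) :
    l i - (x - a i) % q ≤ reach q s a l x := by
  have := Finset.le_sup (f := fun i => (l i - (x - a i) % q).toNat) hi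
  unfold reach
  omega

theorem reach_nonneg (q : ℤ) (s : Finset ι) (a l : ι → ℤ) (x : ℤ) : 0 ≤ reach q s a l x :=
  Int.natCast_nonneg _

theorem reach_add_period (q : ℤ) (s : Finset ι) (a l : ι → ℤ) (x : ℤ) :
    reach q s a l (x + q) = reach q s a l x := by
  unfold reach
  simp only [add_sub_right_comm, Int.add_emod_right]

/-- The cell `g - 1` cannot be collapsed: it is the only one left out by some pair of arcs. -/
def IsCritical (q : ℤ) (s : Finset ι) (a l : ι → ℤ) (g : ℤ) : Prop :=
  ∃ i ∈ s, ∃ j ∈ s, ∀ x, l i ≤ (x - a i) % q → l j ≤ (x - a j) % q → (x - (g - 1)) % q = 0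

namespace IsFamily

variable {q r : ℤ} {s : Finset ι} {a l : ι → ℤ}

theorem exists_cov (h : IsFamily q r s a l) (hr : 0 < r) (x : ℤ) :
    ∃ i ∈ s, (x - a i) % q < l i := by
  by_contra! hc
  have := h.sum_cov x
  rw [Finset.sum_eq_zero fun i hi => cov_eq_zero_iff.2 (hc i hi)] at this
  omega

theorem exists_reach_eq (h : IsFamily q r s a l) (hr : 0 < r) (x : ℤ) :
    ∃ i ∈ s, reach q s a l x = l i - (x - a i) % q ∧ 0 < reach q s a l x := by
  obtain ⟨i, hi, hx⟩ := h.exists_cov hr x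
  have h1 := le_reach (q := q) (a := a) (l := l) hi x
  obtain ⟨j, hj, e⟩ := Finset.exists_mem_eq_sup s ⟨i, hi⟩
    (fun i => (l i - (x - a i) % q).toNat)
  refine ⟨j, hj, ?_⟩
  unfold reach at h1 ⊢
  rw [e] at h1 ⊢
  omega

theorem reach_sub_le (h : IsFamily q r s a l) (hr : 0 < r) (x : ℤ) {k : ℤ} (hk : 0 ≤ k) :
    reach q s a l x - k ≤ reach q s a l (x + k) := by
  obtain ⟨i, hi, e, -⟩ := h.exists_reach_eq hr x
  have h0 := reach_nonneg q s a l (x + k)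
  have h1 := le_reach (q := q) (a := a) (l := l) hi (x + k)
  have h2 := h.len_lt hi
  rcases le_or_gt (reach q s a l x) k with h3 | h3
  · omega
  · have h4 := emod_sub_cases h.pos (a i) x (x + k)
    have e1 : (x + k - x) % q = k := emod_eq_of_range (k := 0) (by omega) (by omega) (by ring)
    omega

theorem reach_add_reach_le (h : IsFamily q r s a l) (hr : 0 < r) (x : ℤ) :
    reach q s a l x + reach q s a l (x + reach q s a l x) ≤ q - 1 := by
  obtain ⟨i, hi, ei, pi⟩ := h.exists_reach_eq hr x
  obtain ⟨j, hj, ej, pj⟩ := h.exists_reach_eq hr (x + reach q s a l x)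
  obtain ⟨z, hzi, hzj⟩ := h.exists_not_cov i hi j hj
  have := h.len_lt hi
  have := h.len_lt hj
  have h1 := emod_sub_cases h.pos (a i) x z
  have h2 := emod_sub_cases h.pos (a j) (x + reach q s a l x) z
  have h3 := emod_sub_cases h.pos x (x + reach q s a l x) z
  have e1 : (x + reach q s a l x - x) % q = reach q s a l x :=
    emod_eq_of_range (k := 0) (by omega) (by omega) (by ring)
  omega

theorem le_reach_add_reach (h : IsFamily q r s a l) (hr : 0 < r) {x : ℤ}
    (hc : IsCritical q s a l x) :
    q - 1 ≤ reach q s a l x + reach q s a l (x + reach q s a l x) := by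
  have hq := h.two_le hr
  have main : ∀ i ∈ s, ∀ j ∈ s, (∀ z, l i ≤ (z - a i) % q → l j ≤ (z - a j) % q →
      (z - (x - 1)) % q = 0) → (x - a i) % q < l i →
      q - 1 ≤ reach q s a l x + reach q s a l (x + reach q s a l x) := by
    intro i hi j hj hij hx
    have li := h.len_lt hi
    have lj := h.len_lt hj
    have pi := h.len_pos i hi
    obtain ⟨z, hzi, hzj⟩ := h.exists_not_cov i hi j hj
    have hz := hij z hzi hzj
    have e1 : (x - (x - 1)) % q = 1 :=
      emod_eq_of_range (k := 0) (by omega) (by omega) (by ring)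
    have h1 := emod_sub_cases h.pos (a i) (x - 1) x
    have h2 := emod_sub_cases h.pos (a i) (x - 1) z
    have hxi : (x - a i) % q = 0 := by omega
    have r1 := le_reach (q := q) (a := a) (l := l) hi x
    have r0 := reach_nonneg q s a l (x + reach q s a l x)
    rcases le_or_gt (q - 1) (l i) with hm | hm
    · omega
    · have r2 := le_reach (q := q) (a := a) (l := l) hj (x + l i)
      have r3 := h.reach_sub_le hr (x + l i) (k := reach q s a l x - l i) (by omega)
      rw [show x + l i + (reach q s a l x - l i) = x + reach q s a l x by ring] at r3
      by_contra! hlt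
      have key : ∀ t, 0 ≤ t → t < q - 1 - l i → (x + l i + t - a j) % q < l j := by
        intro t t0 t1
        by_contra! hcj
        have h3 := emod_sub_cases h.pos (a i) x (x + l i + t)
        have e3 : (x + l i + t - x) % q = l i + t :=
          emod_eq_of_range (k := 0) (by omega) (by omega) (by ring)
        have h4 := emod_sub_cases h.pos (x - 1) x (x + l i + t)
        have := hij (x + l i + t) (by omega) hcj
        omega
      have k0 := key 0 (by omega) (by omega)
      rw [add_zero] at k0
      have k1 := key (l j - (x + l i - a j) % q) (by omega) (by omega)
      have h5 := emod_sub_cases h.pos (a j) (x + l i)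
        (x + l i + (l j - (x + l i - a j) % q))
      have e5 : (x + l i + (l j - (x + l i - a j) % q) - (x + l i)) % q =
          l j - (x + l i - a j) % q :=
        emod_eq_of_range (k := 0) (by omega) (by omega) (by ring)
      omega
  obtain ⟨i, hi, j, hj, hij⟩ := hc
  rcases lt_or_ge ((x - a i) % q) (l i) with h1 | h1
  · exact main i hi j hj hij h1
  · refine main j hj i hi (fun z hz1 hz2 => hij z hz2 hz1) ?_
    by_contra! h2
    have := hij x h1 h2
    have e1 : (x - (x - 1)) % q = 1 :=
      emod_eq_of_range (k := 0) (by omega) (by omega) (by ring)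
    omega

/-- If no cell can be collapsed, then `q = 2 * m + 1` and the arcs have length at most `m`, with
an arc of length `m` starting at every position. -/
theorem exists_of_isCritical (h : IsFamily q r s a l) (hr : 0 < r)
    (hc : ∀ g, IsCritical q s a l g) :
    ∃ m, 0 < m ∧ q = 2 * m + 1 ∧ (∀ i ∈ s, l i ≤ m) ∧
      ∀ g, ∃ i ∈ s, (g - a i) % q = 0 ∧ l i = m := by
  have hsum : ∀ x, reach q s a l x + reach q s a l (x + reach q s a l x) = q - 1 := fun x =>
    le_antisymm (h.reach_add_reach_le hr x) (h.le_reach_add_reach hr (hc x))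
  have hstep : ∀ x, reach q s a l (x + 1) = reach q s a l x := by
    intro x
    have h1 := hsum (x + 1)
    have h2 := hsum (x + 1 + reach q s a l (x + 1))
    rw [show x + 1 + reach q s a l (x + 1) + reach q s a l (x + 1 + reach q s a l (x + 1)) =
      x + q by linarith, reach_add_period] at h2
    linarith
  have hconst : ∀ x, reach q s a l x = reach q s a l 0 := by
    intro x
    induction x with
    | zero => rfl
    | succ n ih => rw [hstep, ih]
    | pred n ih => rw [← ih, ← hstep, sub_add_cancel]
  have hlen : ∀ i ∈ s, l i ≤ reach q s a l 0 := by
    intro i hi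
    have := le_reach (q := q) (a := a) (l := l) hi (a i)
    rw [hconst, emod_sub_self] at this
    omega
  obtain ⟨-, -, -, hpos⟩ := h.exists_reach_eq hr 0
  refine ⟨reach q s a l 0, hpos, ?_, hlen, fun g => ?_⟩
  · have := hsum 0
    rw [hconst (0 + _)] at this
    linarith
  · obtain ⟨i, hi, e, -⟩ := h.exists_reach_eq hr g
    have := hlen i hi
    have := Int.emod_nonneg (g - a i) h.pos.ne'
    rw [hconst] at e
    exact ⟨i, hi, by omega, by omega⟩

end IsFamily

theorem wt_nonneg (q a l a' l' : ℤ) : 0 ≤ wt q a l a' l' := by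
  unfold wt
  split_ifs <;> simp

theorem weight_nonneg (q : ℤ) (s : Finset ι) (a l : ι → ℤ) : 0 ≤ weight q s a l :=
  Finset.sum_nonneg fun _ _ => Finset.sum_nonneg fun _ _ => wt_nonneg _ _ _ _ _

/-! ### Summation over all positions -/

theorem sum_emod_sub_right {q : ℤ} (hq : 0 < q) (x : ℤ) (f : ℤ → ℤ) :
    ∑ g ∈ Finset.Ico 0 q, f ((g - x) % q) = ∑ d ∈ Finset.Ico 0 q, f d := by
  refine Finset.sum_nbij' (fun g => (g - x) % q) (fun d => (d + x) % q) ?_ ?_ ?_ ?_ ?_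
  · exact fun g _ => Finset.mem_Ico.2 ⟨Int.emod_nonneg _ hq.ne', Int.emod_lt_of_pos _ hq⟩
  · exact fun g _ => Finset.mem_Ico.2 ⟨Int.emod_nonneg _ hq.ne', Int.emod_lt_of_pos _ hq⟩
  · intro g hg
    rw [Finset.mem_Ico] at hg
    simp [Int.emod_eq_of_lt hg.1 hg.2]
  · intro g hg
    rw [Finset.mem_Ico] at hg
    simp [Int.emod_eq_of_lt hg.1 hg.2]
  · exact fun _ _ => rfl

theorem sum_emod_sub_left {q : ℤ} (hq : 0 < q) (x : ℤ) (f : ℤ → ℤ) :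
    ∑ g ∈ Finset.Ico 0 q, f ((x - g) % q) = ∑ d ∈ Finset.Ico 0 q, f d := by
  refine Finset.sum_nbij' (fun g => (x - g) % q) (fun d => (x - d) % q) ?_ ?_ ?_ ?_ ?_
  · exact fun g _ => Finset.mem_Ico.2 ⟨Int.emod_nonneg _ hq.ne', Int.emod_lt_of_pos _ hq⟩
  · exact fun g _ => Finset.mem_Ico.2 ⟨Int.emod_nonneg _ hq.ne', Int.emod_lt_of_pos _ hq⟩
  · intro g hg
    rw [Finset.mem_Ico] at hg
    simp [Int.emod_eq_of_lt hg.1 hg.2]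
  · intro g hg
    rw [Finset.mem_Ico] at hg
    simp [Int.emod_eq_of_lt hg.1 hg.2]
  · exact fun _ _ => rfl

theorem sum_Ico_indicator {q u v : ℤ} (hu : 0 ≤ u) (huv : u ≤ v) (hv : v ≤ q) (c : ℤ) :
    ∑ d ∈ Finset.Ico 0 q, (if u ≤ d ∧ d < v then c else 0) = c * (v - u) := by
  rw [← Finset.sum_filter]
  have : (Finset.Ico 0 q).filter (fun d => u ≤ d ∧ d < v) = Finset.Ico u v := by
    ext d
    simp only [Finset.mem_filter, Finset.mem_Ico]
    omega
  rw [this, Finset.sum_const, Int.card_Ico, nsmul_eq_mul, Int.toNat_of_nonneg (by omega)]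
  ring

theorem sum_cov_cells {q l : ℤ} (hq : 0 < q) (hl : 0 ≤ l) (hlq : l ≤ q) (a : ℤ) :
    ∑ x ∈ Finset.Ico 0 q, cov q a l x = l := by
  unfold cov
  rw [sum_emod_sub_right hq a (fun d => if d < l then 1 else 0)]
  convert sum_Ico_indicator le_rfl hl hlq 1 using 1
  · refine Finset.sum_congr rfl fun d hd => ?_
    simp [(Finset.mem_Ico.1 hd).1]
  · ring

theorem sum_cov_starts {q l : ℤ} (hq : 0 < q) (hl : 0 ≤ l) (hlq : l ≤ q) (x : ℤ) :
    ∑ g ∈ Finset.Ico 0 q, cov q g l x = l := by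
  unfold cov
  rw [sum_emod_sub_left hq x (fun d => if d < l then 1 else 0)]
  convert sum_Ico_indicator le_rfl hl hlq 1 using 1
  · refine Finset.sum_congr rfl fun d hd => ?_
    simp [(Finset.mem_Ico.1 hd).1]
  · ring

theorem sum_wt_right {q l m : ℤ} (hl : 0 < l) (hlm : l ≤ m) (hm : m < q) (a : ℤ) :
    ∑ g ∈ Finset.Ico 0 q, wt q a l g m = 2 * l - 1 := by
  unfold wt
  rw [sum_emod_sub_right (by omega) a
    (fun d => if 0 < d ∧ d < l ∧ l < d + m then 2 else if d = l then 1 else 0)]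
  have h1 := sum_Ico_indicator (q := q) (u := 1) (v := l) (by omega) (by omega) (by omega) 2
  have h2 := sum_Ico_indicator (q := q) (u := l) (v := l + 1) (by omega) (by omega) (by omega) 1
  rw [show 2 * l - 1 = 2 * (l - 1) + 1 * (l + 1 - l) by ring, ← h1, ← h2,
    ← Finset.sum_add_distrib]
  refine Finset.sum_congr rfl fun d hd => ?_
  split_ifs <;> omega

theorem sum_wt_left {q l m : ℤ} (hl : 0 < l) (hlm : l ≤ m) (hm : m < q) (a : ℤ) :
    ∑ g ∈ Finset.Ico 0 q, wt q g m a l = 2 * l - 1 := by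
  unfold wt
  rw [sum_emod_sub_left (by omega) a
    (fun d => if 0 < d ∧ d < m ∧ m < d + l then 2 else if d = m then 1 else 0)]
  have h1 := sum_Ico_indicator (q := q) (u := m - l + 1) (v := m) (by omega) (by omega)
    (by omega) 2
  have h2 := sum_Ico_indicator (q := q) (u := m) (v := m + 1) (by omega) (by omega) (by omega) 1
  rw [show 2 * l - 1 = 2 * (m - (m - l + 1)) + 1 * (m + 1 - m) by ring, ← h1, ← h2,
    ← Finset.sum_add_distrib]
  refine Finset.sum_congr rfl fun d hd => ?_
  split_ifs <;> omega

theorem sum_atPos {q : ℤ} (hq : 0 < q) (a : ℤ) : ∑ g ∈ Finset.Ico 0 q, atPos q g a = 1 := by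
  unfold atPos
  rw [sum_emod_sub_left hq a (fun d => if d = 0 then 1 else 0)]
  simp [hq]

theorem sum_atPos_mul_le {q a l a' l' : ℤ} (hl : 0 < l) (hlq : l < q) :
    ∑ g ∈ Finset.Ico 0 q, atPos q g (a + l) * atPos q g a' ≤ wt q a l a' l' := by
  have hq : 0 < q := by omega
  calc _ ≤ ∑ g ∈ Finset.Ico 0 q, atPos q g (a + l) * wt q a l a' l' := by
        refine Finset.sum_le_sum fun g _ => ?_
        have h1 := emod_sub_cases hq g (a + l) a'
        have h2 := emod_sub_cases hq a (a + l) a'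
        have e1 : (a + l - a) % q = l := emod_eq_of_range (k := 0) hl.le hlq (by ring)
        have h3 := wt_nonneg q a l a' l'
        unfold atPos wt at *
        split_ifs at * <;> omega
    _ = _ := by rw [← Finset.sum_mul, sum_atPos hq, one_mul]

theorem cov_congr_start {q a g : ℤ} (hq : 0 < q) (h : (g - a) % q = 0) (l x : ℤ) :
    cov q a l x = cov q g l x := by
  have := emod_sub_cases hq a g x
  unfold cov
  rw [show (x - a) % q = (x - g) % q by omega]

theorem wt_congr_left {q a g : ℤ} (hq : 0 < q) (h : (g - a) % q = 0) (l a' l' : ℤ) :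
    wt q a l a' l' = wt q g l a' l' := by
  have := emod_sub_cases hq a g a'
  unfold wt
  rw [show (a' - a) % q = (a' - g) % q by omega]

theorem wt_congr_right {q a g : ℤ} (hq : 0 < q) (h : (g - a) % q = 0) (a' l l' : ℤ) :
    wt q a' l' a l = wt q a' l' g l := by
  have := emod_sub_cases hq a' a g
  have := emod_sub_cases hq a' g a
  unfold wt
  rw [show (a - a') % q = (g - a') % q by omega]

namespace IsFamily

variable {q r m : ℤ} {s : Finset ι} {a l : ι → ℤ}

theorem nonneg (h : IsFamily q r s a l) : 0 ≤ r := by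
  rw [← h.sum_cov 0]
  exact Finset.sum_nonneg fun _ _ => cov_nonneg _ _ _ _

theorem sum_len (h : IsFamily q r s a l) : ∑ i ∈ s, l i = q * r := by
  rw [Finset.sum_congr rfl fun i hi => (sum_cov_cells h.pos (h.len_pos i hi).le
    (h.len_lt hi).le (a i)).symm, Finset.sum_comm, Finset.sum_congr rfl fun x _ => h.sum_cov x]
  simp [h.pos.le]

theorem card_le (h : IsFamily q r s a l) : (s.card : ℤ) ≤ q * r := by
  rw [← h.sum_len, Finset.cast_card]
  exact Finset.sum_le_sum fun i hi => h.len_pos i hi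

theorem card_sq_le (h : IsFamily q r s a l) : (s.card : ℤ) ^ 2 ≤ q * weight q s a l := by
  have h1 : ∑ g ∈ Finset.Ico 0 q, ∑ i ∈ s, atPos q g (a i) = s.card := by
    rw [Finset.sum_comm, Finset.sum_congr rfl fun i _ => sum_atPos h.pos (a i)]
    simp
  have h2 : ∑ g ∈ Finset.Ico 0 q, (∑ i ∈ s, atPos q g (a i)) ^ 2 ≤ weight q s a l := by
    calc _ = ∑ g ∈ Finset.Ico 0 q, ∑ i ∈ s, ∑ j ∈ s,
          atPos q g (a i + l i) * atPos q g (a j) := by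
          refine Finset.sum_congr rfl fun g _ => ?_
          rw [← Finset.sum_mul_sum, ← h.sum_start_eq_sum_end, sq]
      _ = ∑ i ∈ s, ∑ j ∈ s, ∑ g ∈ Finset.Ico 0 q,
          atPos q g (a i + l i) * atPos q g (a j) := by
          rw [Finset.sum_comm]
          exact Finset.sum_congr rfl fun i _ => Finset.sum_comm
      _ ≤ _ := Finset.sum_le_sum fun i hi => Finset.sum_le_sum fun j _ =>
          sum_atPos_mul_le (h.len_pos i hi) (h.len_lt hi)
  have h3 := sq_sum_le_card_mul_sum_sq (s := Finset.Ico 0 q)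
    (f := fun g => ∑ i ∈ s, atPos q g (a i))
  rw [h1, Int.card_Ico, sub_zero, Int.toNat_of_nonneg h.pos.le] at h3
  exact h3.trans (mul_le_mul_of_nonneg_left h2 h.pos.le)

/-- Removing one arc of length `m` starting at each position. -/
theorem exists_remove (h : IsFamily q r s a l) (hm : 0 < m) (hmq : m < q)
    (hle : ∀ i ∈ s, l i ≤ m) (hex : ∀ g, ∃ i ∈ s, (g - a i) % q = 0 ∧ l i = m) :
    ∃ t, IsFamily q (r - m) t a l ∧
      weight q s a l = weight q t a l + 4 * q * (r - m) - 2 * t.card + q * (2 * m - 1) := by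
  classical
  choose u hu hua hul using hex
  have hinj : Set.InjOn u (Finset.Ico 0 q) := by
    intro x hx y hy hxy
    rw [Finset.coe_Ico, Set.mem_Ico] at hx hy
    have h1 := hua x
    rw [hxy] at h1
    have h2 := emod_sub_cases h.pos x (a (u y)) y
    have h3 := emod_sub_cases h.pos x (a (u y)) x
    have h4 := emod_sub_self q x
    have h5 := hua y
    have h6 : (y - x) % q = 0 := by omega
    obtain ⟨k, hk⟩ := Int.dvd_of_emod_eq_zero h6
    have : k = 0 := by
      by_contra hk0
      rcases lt_or_gt_of_ne hk0 with hk1 | hk1 <;> nlinarith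
    subst this
    omega
  set T := (Finset.Ico 0 q).image u with hT
  have hTs : T ⊆ s := by
    intro i hi
    obtain ⟨g, -, rfl⟩ := Finset.mem_image.1 hi
    exact hu g
  have hsum : ∀ f : ι → ℤ, ∑ i ∈ s, f i = ∑ i ∈ s \ T, f i + ∑ g ∈ Finset.Ico 0 q, f (u g) := by
    intro f
    rw [← Finset.sum_sdiff hTs, hT, Finset.sum_image hinj]
  have hfam : IsFamily q (r - m) (s \ T) a l := by
    have hsub : s \ T ⊆ s := Finset.sdiff_subset
    refine ⟨h.pos, fun i hi => h.len_pos i (hsub hi), fun x => ?_,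
      fun i hi j hj => h.exists_not_cov i (hsub hi) j (hsub hj)⟩
    have h1 := h.sum_cov x
    rw [hsum, Finset.sum_congr (g := fun g => cov q g m x) rfl fun g _ => by
      rw [cov_congr_start h.pos (hua g), hul], sum_cov_starts h.pos hm.le hmq.le] at h1
    linarith
  refine ⟨s \ T, hfam, ?_⟩
  have hright : ∀ i ∈ s, ∑ g ∈ Finset.Ico 0 q, wt q (a i) (l i) (a (u g)) (l (u g)) =
      2 * l i - 1 := by
    intro i hi
    rw [← sum_wt_right (h.len_pos i hi) (hle i hi) hmq (a i)]
    exact Finset.sum_congr rfl fun g _ => by rw [wt_congr_right h.pos (hua g), hul]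
  have hleft : ∀ i ∈ s, ∑ g ∈ Finset.Ico 0 q, wt q (a (u g)) (l (u g)) (a i) (l i) =
      2 * l i - 1 := by
    intro i hi
    rw [← sum_wt_left (h.len_pos i hi) (hle i hi) hmq (a i)]
    exact Finset.sum_congr rfl fun g _ => by rw [wt_congr_left h.pos (hua g), hul]
  have hlin : ∑ i ∈ s \ T, (2 * l i - 1) = 2 * (q * (r - m)) - (s \ T).card := by
    rw [Finset.sum_sub_distrib, ← Finset.mul_sum, hfam.sum_len]
    simp
  have hU : ∑ g ∈ Finset.Ico 0 q, (2 * l (u g) - 1) = q * (2 * m - 1) := by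
    rw [Finset.sum_congr rfl fun g _ => by rw [hul g]]
    simp [h.pos.le, mul_sub]
  unfold weight
  rw [hsum]
  simp only [hsum (fun j => wt q _ _ (a j) (l j)), Finset.sum_add_distrib]
  rw [Finset.sum_congr rfl fun i hi => hright i (Finset.sdiff_subset hi),
    Finset.sum_congr rfl fun g _ => hright (u g) (hu g), hU, hlin,
    Finset.sum_comm (s := Finset.Ico 0 q),
    Finset.sum_congr rfl fun i hi => hleft i (Finset.sdiff_subset hi), hlin]
  ring

/-- The area bound for families of arcs in `ℤ/q`. -/
theorem three_mul_sq_le (h : IsFamily q r s a l) : 3 * r ^ 2 ≤ weight q s a l := by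
  induction hN : r.toNat + q.toNat using Nat.strong_induction_on generalizing q r s a l with
  | _ N ih =>
  subst hN
  rcases h.nonneg.eq_or_lt with hr | hr
  · rw [← hr]
    simpa using weight_nonneg q s a l
  have hq := h.two_le hr
  by_cases hc : ∀ g, IsCritical q s a l g
  · obtain ⟨m, hm, hqm, hle, hex⟩ := h.exists_of_isCritical hr hc
    obtain ⟨t, ht, hw⟩ := h.exists_remove hm (by omega) hle hex
    have h1 := ih ((r - m).toNat + q.toNat) (by omega) ht rfl
    have h2 := ht.card_sq_le
    have h3 := ht.nonneg
    have h5 := ht.card_le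
    rw [hw]
    obtain ⟨p, rfl⟩ : ∃ p, r = p + m := ⟨r - m, by ring⟩
    rw [add_sub_cancel_right] at *
    generalize weight q t a l = w at *
    generalize (t.card : ℤ) = n at *
    have h4 : 3 * p ^ 2 - (2 * m + 4) * p ≤ w - 2 * n := by
      rcases le_or_gt n ((m + 2) * p) with hn | hn
      · nlinarith
      · have hq0 : 0 < q := by omega
        rw [← mul_le_mul_iff_right₀ hq0]
        subst hqm
        rcases lt_or_ge p 2 with hp | hp
        · obtain rfl | rfl : p = 0 ∨ p = 1 := by omega
          · omega
          · nlinarith [sq_nonneg (n - (2 * m + 1))]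
        · have : ((m + 2) * p) ^ 2 - 2 * (2 * m + 1) * ((m + 2) * p) ≤
              n ^ 2 - 2 * (2 * m + 1) * n := by
            have hM : (m + 2) * 2 ≤ (m + 2) * p := mul_le_mul_of_nonneg_left hp (by omega)
            generalize (m + 2) * p = k at *
            nlinarith [mul_nonneg (show 0 ≤ n - k by omega)
              (show 0 ≤ n + k - 2 * (2 * m + 1) by omega)]
          nlinarith [mul_nonneg (sq_nonneg p) (sq_nonneg (m - 1))]
    nlinarith
  · push Not at hc
    obtain ⟨g, hg⟩ := hc
    have hg' : ∀ i ∈ s, ∀ j ∈ s, ∃ x, (x - (g - 1)) % q ≠ 0 ∧ l i ≤ (x - a i) % q ∧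
        l j ≤ (x - a j) % q := by
      intro i hi j hj
      by_contra! hx
      exact hg ⟨i, hi, j, hj, fun x h1 h2 => by
        by_contra h0
        exact absurd (hx x h0 h1) (by omega)⟩
    exact (ih (r.toNat + (q - 1).toNat) (by omega) (h.collapse hr hg') rfl).trans
      (h.weight_collapse_le hr g)

end IsFamily

end CyclicFamily

/-! ### Grids on the circle -/

/-- A strictly increasing sequence of reals that is `q`-periodic modulo `c`. -/
structure IsGrid (c : ℝ) (q : ℤ) (pos : ℤ → ℝ) : Prop where
  strictMono : StrictMono pos
  add_period : ∀ z, pos (z + q) = pos z + c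

namespace IsGrid

variable {c : ℝ} {q : ℤ} {pos : ℤ → ℝ}

theorem add_mul (h : IsGrid c q pos) (z k : ℤ) : pos (z + q * k) = pos z + c * k := by
  induction k with
  | zero => simp
  | succ n ih =>
    rw [show z + q * ((n : ℤ) + 1) = z + q * n + q by ring, h.add_period, ih]
    push_cast
    ring
  | pred n ih =>
    have := h.add_period (z + q * (-(n : ℤ) - 1))
    rw [show z + q * (-(n : ℤ) - 1) + q = z + q * (-n) by ring, ih] at this
    push_cast at this ⊢
    linarith

theorem period_pos (h : IsGrid c q pos) (hc : 0 < c) : 0 < q := by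
  have h1 := h.add_period 0
  rw [zero_add] at h1
  exact h.strictMono.lt_iff_lt.1 (by linarith)

/-- Every real lies in a cell of the grid. -/
theorem exists_cell (h : IsGrid c q pos) (hc : 0 < c) (y : ℝ) :
    ∃ x, pos x ≤ y ∧ y < pos (x + 1) := by
  have hb : ∃ b : ℤ, ∀ z, pos z ≤ y → z ≤ b := by
    obtain ⟨n, hn⟩ := exists_nat_gt ((y - pos 0) / c)
    rw [div_lt_iff₀ hc] at hn
    refine ⟨q * n, fun z hz => h.strictMono.le_iff_le.1 ?_⟩
    have := h.add_mul 0 n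
    rw [zero_add] at this
    rw [this]
    push_cast
    linarith
  have hi : ∃ z, pos z ≤ y := by
    obtain ⟨n, hn⟩ := exists_nat_gt ((pos 0 - y) / c)
    rw [div_lt_iff₀ hc] at hn
    refine ⟨0 + q * (-n : ℤ), ?_⟩
    rw [h.add_mul]
    push_cast
    linarith
  obtain ⟨x, hx, hmax⟩ := Int.exists_greatest_of_bdd hb hi
  refine ⟨x, hx, ?_⟩
  by_contra! hlt
  have := hmax _ hlt
  omega

end IsGrid

theorem AddCircle.coe_eq_coe_iff_exists {c x y : ℝ} :
    (x : AddCircle c) = (y : AddCircle c) ↔ ∃ k : ℤ, x = y + c * k := by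
  rw [← sub_eq_zero, ← AddCircle.coe_sub, AddCircle.coe_eq_zero_iff]
  constructor <;> rintro ⟨k, hk⟩ <;> refine ⟨k, ?_⟩ <;> simp only [zsmul_eq_mul] at * <;> linarith

/-- A finite set of points of the circle is contained in a grid. -/
theorem exists_isGrid {c : ℝ} (hc : 0 < c) (F : Finset ℝ) (hF : F.Nonempty) :
    ∃ (q : ℤ) (pos : ℤ → ℝ), IsGrid c q pos ∧ ∀ x ∈ F, ∃ z, pos z = x := by
  classical
  set E := F.image (toIcoMod hc 0) with hE
  have hE0 : 0 < E.card := Finset.card_pos.2 (hF.image _)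
  have hEm : ∀ i, E.orderEmbOfFin rfl i ∈ Set.Ico 0 c := by
    intro i
    obtain ⟨x, -, hx⟩ := Finset.mem_image.1 (E.orderEmbOfFin_mem rfl i)
    rw [← hx]
    simpa using toIcoMod_mem_Ico hc 0 x
  have hq : (0 : ℤ) < E.card := by exact_mod_cast hE0
  have hlt : ∀ z : ℤ, (z % E.card).toNat < E.card := fun z => by
    have := Int.emod_lt_of_pos z hq
    have := Int.emod_nonneg z hq.ne'
    omega
  set pos : ℤ → ℝ := fun z =>
    E.orderEmbOfFin rfl ⟨(z % E.card).toNat, hlt z⟩ + c * (z / E.card : ℤ) with hpos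
  have hval : ∀ (i : Fin E.card) (k : ℤ),
      pos (i + E.card * k) = E.orderEmbOfFin rfl i + c * k := by
    intro i k
    have h0 : ((i : ℤ)) < E.card := by exact_mod_cast i.2
    have h1 : ((i : ℤ) + E.card * k) % E.card = i :=
      CyclicFamily.emod_eq_of_range (by omega) h0 rfl
    have h2 : ((i : ℤ) + E.card * k) / E.card = k := by
      rw [Int.add_mul_ediv_left _ _ hq.ne', Int.ediv_eq_zero_of_lt (by omega) h0, zero_add]
    simp only [hpos, h1, h2, Int.toNat_natCast]
  have hrep : ∀ z : ℤ, ∃ (i : Fin E.card) (k : ℤ), z = i + E.card * k := by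
    intro z
    refine ⟨⟨(z % E.card).toNat, hlt z⟩, z / E.card, ?_⟩
    have h1 := Int.emod_nonneg z hq.ne'
    have h2 := Int.emod_add_mul_ediv z E.card
    simp only
    omega
  refine ⟨E.card, pos, ⟨strictMono_int_of_lt_succ fun z => ?_, fun z => ?_⟩, fun x hx => ?_⟩
  · obtain ⟨i, k, rfl⟩ := hrep z
    rcases Nat.lt_or_ge (i + 1) E.card with hi | hi
    · rw [show (i : ℤ) + E.card * k + 1 = ((⟨i + 1, hi⟩ : Fin E.card) : ℕ) + E.card * k by
        push_cast; ring, hval, hval]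
      have : E.orderEmbOfFin rfl i < E.orderEmbOfFin rfl ⟨i + 1, hi⟩ := by
        rw [OrderEmbedding.lt_iff_lt, Fin.lt_def]
        simp
      linarith
    · have hi' : (i : ℕ) + 1 = E.card := by omega
      rw [show (i : ℤ) + E.card * k + 1 = ((⟨0, hE0⟩ : Fin E.card) : ℕ) + E.card * (k + 1) by
        have : ((i : ℕ) : ℤ) + 1 = E.card := by exact_mod_cast hi'
        push_cast; linarith, hval, hval]
      have h1 := (hEm i).2
      have h2 := (hEm ⟨0, hE0⟩).1
      push_cast
      linarith
  · obtain ⟨i, k, rfl⟩ := hrep z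
    rw [show (i : ℤ) + E.card * k + E.card = i + E.card * (k + 1) by ring, hval, hval]
    push_cast
    ring
  · have hm : toIcoMod hc 0 x ∈ Set.range (E.orderEmbOfFin rfl) := by
      rw [Finset.range_orderEmbOfFin]
      exact Finset.mem_image_of_mem _ hx
    obtain ⟨i, hi⟩ := hm
    refine ⟨i + E.card * toIcoDiv hc 0 x, ?_⟩
    rw [hval, hi]
    have := toIcoMod_add_toIcoDiv_zsmul hc 0 x
    rw [zsmul_eq_mul] at this
    linarith

/-- Translates of `x` by multiples of `q` meet `[z, w)` exactly if the offset of `x` from `z` is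
small enough. -/
theorem exists_add_mul_mem_iff {q x z w : ℤ} (hq : 0 < q) (hw : w - z ≤ q) :
    (∃ k : ℤ, z ≤ x + q * k ∧ x + q * k < w) ↔ (x - z) % q < w - z := by
  constructor
  · rintro ⟨k, h1, h2⟩
    rw [CyclicFamily.emod_eq_of_range (t := x + q * k - z) (k := -k) (by omega) (by omega)
      (by ring)]
    omega
  · intro h
    have h1 := Int.emod_nonneg (x - z) hq.ne'
    have h2 := Int.emod_add_mul_ediv (x - z) q
    refine ⟨-((x - z) / q), ?_⟩
    rw [mul_neg]
    omega

namespace IsGrid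

variable {c : ℝ} {q : ℤ} {pos : ℤ → ℝ}

theorem coe_eq_coe_iff (h : IsGrid c q pos) {x y : ℤ} :
    (pos x : AddCircle c) = (pos y : AddCircle c) ↔ (x - y) % q = 0 := by
  rw [AddCircle.coe_eq_coe_iff_exists, ← Int.dvd_iff_emod_eq_zero]
  simp only [← h.add_mul, h.strictMono.injective.eq_iff]
  exact ⟨fun ⟨k, hk⟩ => ⟨k, by linarith⟩, fun ⟨k, hk⟩ => ⟨k, by linarith⟩⟩

end IsGrid

namespace Arc

variable {c : ℝ}

theorem coe_mem_toSet_iff (α : Arc c) (y : ℝ) :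
    (y : AddCircle c) ∈ α.toSet ↔ ∃ k : ℤ, α.a ≤ y + c * k ∧ y + c * k ≤ α.b := by
  constructor
  · rintro ⟨x, hx, hxy⟩
    obtain ⟨k, rfl⟩ := AddCircle.coe_eq_coe_iff_exists.1 hxy
    exact ⟨k, hx.1, hx.2⟩
  · rintro ⟨k, h1, h2⟩
    exact ⟨y + c * k, ⟨h1, h2⟩, AddCircle.coe_eq_coe_iff_exists.2 ⟨k, rfl⟩⟩

theorem SharesEndpoint.symm {α β : Arc c} (h : α.SharesEndpoint β) : β.SharesEndpoint α := by
  unfold SharesEndpoint at *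
  rwa [Set.inter_comm]

theorem Crosses.symm {α β : Arc c} (h : α.Crosses β) : β.Crosses α :=
  ⟨fun hs => h.1 hs.symm, h.2.symm⟩

/-- The arc `α` goes from the point `z` to the point `w` of the grid `pos`. -/
structure OnGrid (pos : ℤ → ℝ) (z w : ℤ) (α : Arc c) : Prop where
  pos_left : pos z = α.a
  pos_right : pos w = α.b

namespace OnGrid

variable {q : ℤ} {pos : ℤ → ℝ} {z w z' w' : ℤ} {α β : Arc c}

theorem lt (hα : OnGrid pos z w α) (h : IsGrid c q pos) : z < w :=
  h.strictMono.lt_iff_lt.1 (by rw [hα.pos_left, hα.pos_right]; linarith [α.width_pos])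

theorem lt_add (hα : OnGrid pos z w α) (h : IsGrid c q pos) : w < z + q :=
  h.strictMono.lt_iff_lt.1
    (by rw [h.add_period, hα.pos_left, hα.pos_right]; linarith [α.width_lt])

theorem pos_mem_iff (hα : OnGrid pos z w α) (h : IsGrid c q pos) (hc : 0 < c) (x : ℤ) :
    (pos x : AddCircle c) ∈ α.toSet ↔ (x - z) % q ≤ w - z := by
  have h1 := hα.lt h
  have h2 := hα.lt_add h
  rw [coe_mem_toSet_iff, ← hα.pos_left, ← hα.pos_right]
  simp only [← h.add_mul, h.strictMono.le_iff_le, ← Int.lt_add_one_iff (b := w)]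
  rw [exists_add_mul_mem_iff (h.period_pos hc) (by omega)]
  omega

theorem mem_iff_of_cell (hα : OnGrid pos z w α) (h : IsGrid c q pos) (hc : 0 < c) {x : ℤ} {y : ℝ}
    (h1 : pos x < y) (h2 : y < pos (x + 1)) :
    (y : AddCircle c) ∈ α.toSet ↔ (x - z) % q < w - z := by
  rw [coe_mem_toSet_iff, ← exists_add_mul_mem_iff (h.period_pos hc)
    (by linarith [hα.lt_add h]), ← hα.pos_left, ← hα.pos_right]
  refine exists_congr fun k => and_congr ?_ ?_
  · constructor
    · intro hz
      have : pos z < pos (x + 1 + q * k) := by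
        rw [h.add_mul]
        linarith
      have := h.strictMono.lt_iff_lt.1 this
      omega
    · intro hz
      have := h.strictMono.le_iff_le.2 hz
      rw [h.add_mul] at this
      linarith
  · constructor
    · intro hw
      have : pos (x + q * k) < pos w := by
        rw [h.add_mul]
        linarith
      exact h.strictMono.lt_iff_lt.1 this
    · intro hw
      have := h.strictMono.le_iff_le.2 (show x + 1 + q * k ≤ w by omega)
      rw [h.add_mul] at this
      linarith

theorem mem_of_cell (hα : OnGrid pos z w α) (h : IsGrid c q pos) (hc : 0 < c) {x : ℤ} {y : ℝ}
    (h1 : pos x ≤ y) (h2 : y < pos (x + 1)) (hx : (x - z) % q < w - z) :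
    (y : AddCircle c) ∈ α.toSet := by
  rcases h1.eq_or_lt with rfl | h1
  · exact (hα.pos_mem_iff h hc x).2 hx.le
  · exact (hα.mem_iff_of_cell h hc h1 h2).2 hx

theorem not_mem_endpoints_of_cell (hα : OnGrid pos z w α) (h : IsGrid c q pos) {x : ℤ} {y : ℝ}
    (h1 : pos x < y) (h2 : y < pos (x + 1)) : (y : AddCircle c) ∉ α.endpoints := by
  have key : ∀ v, (y : AddCircle c) ≠ (pos v : AddCircle c) := by
    intro v hv
    obtain ⟨k, rfl⟩ := AddCircle.coe_eq_coe_iff_exists.1 hv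
    rw [← h.add_mul, h.strictMono.lt_iff_lt] at h1 h2
    omega
  rintro (hy | hy)
  · exact key z (by rw [hy, hα.pos_left]; rfl)
  · exact key w (by rw [Set.mem_singleton_iff.1 hy, hα.pos_right]; rfl)

theorem sharesEndpoint_iff (hα : OnGrid pos z w α) (hβ : OnGrid pos z' w' β)
    (h : IsGrid c q pos) : α.SharesEndpoint β ↔
      (z - z') % q = 0 ∨ (z - w') % q = 0 ∨ (w - z') % q = 0 ∨ (w - w') % q = 0 := by
  have e1 : α.init = (pos z : AddCircle c) := by rw [hα.pos_left]; rfl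
  have e2 : α.term = (pos w : AddCircle c) := by rw [hα.pos_right]; rfl
  have e3 : β.init = (pos z' : AddCircle c) := by rw [hβ.pos_left]; rfl
  have e4 : β.term = (pos w' : AddCircle c) := by rw [hβ.pos_right]; rfl
  simp only [← h.coe_eq_coe_iff, ← e1, ← e2, ← e3, ← e4]
  unfold SharesEndpoint endpoints Set.Nonempty
  simp only [Set.mem_inter_iff, Set.mem_insert_iff, Set.mem_singleton_iff]
  constructor
  · rintro ⟨p, rfl | rfl, h2 | h2⟩ <;> simp [h2]
  · rintro (h1 | h1 | h1 | h1)
    · exact ⟨_, Or.inl rfl, Or.inl h1⟩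
    · exact ⟨_, Or.inl rfl, Or.inr h1⟩
    · exact ⟨_, Or.inr rfl, Or.inl h1⟩
    · exact ⟨_, Or.inr rfl, Or.inr h1⟩

open Classical in
theorem wt_le (hα : OnGrid pos z w α) (hβ : OnGrid pos z' w' β) (h : IsGrid c q pos) (hc : 0 < c)
    (hcov : ¬ ((z' - z) % q ≤ w - z ∧ q ≤ (z' - z) % q + (w' - z'))) :
    CyclicFamily.wt q z (w - z) z' (w' - z') ≤
      2 * (if α.Crosses β then 1 else 0) + if α ≠ β ∧ α.SharesEndpoint β then 1 else 0 := by
  have hq := h.period_pos hc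
  have a1 := hα.lt h
  have a2 := hα.lt_add h
  have b1 := hβ.lt h
  have b2 := hβ.lt_add h
  have ew : (w - z) % q = w - z := Int.emod_eq_of_lt (by omega) (by omega)
  have ew' : (w' - z') % q = w' - z' := Int.emod_eq_of_lt (by omega) (by omega)
  have c1 := CyclicFamily.emod_sub_cases hq z z' w'
  have e0 := CyclicFamily.emod_sub_self q z
  have hsh := hα.sharesEndpoint_iff hβ h
  have hcross : 0 < (z' - z) % q ∧ (z' - z) % q < w - z ∧ w - z < (z' - z) % q + (w' - z') →
      α.Crosses β := by
    intro hd
    refine ⟨fun hs => ?_, Or.inl (Or.inl ⟨?_, ?_⟩)⟩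
    · have e1 : (w' - z) % q = (z' - z) % q + (w' - z') := by omega
      rcases hsh.1 hs with hs | hs | hs | hs
      · have := CyclicFamily.emod_sub_cases hq z z' z
        omega
      · have := CyclicFamily.emod_sub_cases hq z w' z
        omega
      · have := CyclicFamily.emod_sub_cases hq z z' w
        omega
      · have := CyclicFamily.emod_sub_cases hq z w' w
        omega
    · rw [show β.init = (pos z' : AddCircle c) by rw [hβ.pos_left]; rfl, hα.pos_mem_iff h hc]
      omega
    · rw [show β.term = (pos w' : AddCircle c) by rw [hβ.pos_right]; rfl, hα.pos_mem_iff h hc]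
      omega
  have hshare : (z' - z) % q = w - z → α ≠ β ∧ α.SharesEndpoint β := by
    intro hd
    have c6 := CyclicFamily.emod_sub_cases hq z z' w
    refine ⟨?_, hsh.2 (Or.inr (Or.inr (Or.inl (by omega))))⟩
    rintro rfl
    have := h.strictMono.injective (hα.pos_left.trans hβ.pos_left.symm)
    subst this
    omega
  clear c1
  unfold CyclicFamily.wt
  split_ifs <;> first | omega | tauto

theorem wt_eq_zero_or_wt_eq_zero (hα : OnGrid pos z w α) (hβ : OnGrid pos z' w' β)
    (h : IsGrid c q pos) (hc : 0 < c)
    (hcov : ¬ ((z - z') % q ≤ w' - z' ∧ q ≤ (z - z') % q + (w - z))) :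
    CyclicFamily.wt q z (w - z) z' (w' - z') = 0 ∨
      CyclicFamily.wt q z' (w' - z') z (w - z) = 0 := by
  have a1 := hα.lt h
  have b1 := hβ.lt h
  have c4 := CyclicFamily.emod_sub_cases (h.period_pos hc) z z' z
  have e0 := CyclicFamily.emod_sub_self q z
  unfold CyclicFamily.wt
  split_ifs <;> omega

end OnGrid

end Arc

open Classical in
/-- The area as a sum over ordered pairs. -/
theorem four_mul_diskArea {c : ℝ} (I : Finset (Arc c)) :
    4 * diskArea I = ((∑ α ∈ I, ∑ β ∈ I, (2 * (if α.Crosses β then 1 else 0) +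
      if α ≠ β ∧ α.SharesEndpoint β then 1 else 0) : ℤ) : ℝ) := by
  have h1 : Nat.card {p : Arc c × Arc c // p.1 ∈ I ∧ p.2 ∈ I ∧ p.1.Crosses p.2} =
      ((I ×ˢ I).filter fun p => p.1.Crosses p.2).card :=
    Nat.subtype_card _ fun p => by simp [and_assoc]
  have h2 : Nat.card {p : Arc c × Arc c // p.1 ∈ I ∧ p.2 ∈ I ∧ p.1 ≠ p.2 ∧
      p.1.SharesEndpoint p.2} =
      ((I ×ˢ I).filter fun p => p.1 ≠ p.2 ∧ p.1.SharesEndpoint p.2).card :=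
    Nat.subtype_card _ fun p => by simp [and_assoc]
  unfold diskArea
  rw [h1, h2, ← Finset.sum_product' I I fun α β => 2 * (if α.Crosses β then (1 : ℤ) else 0) +
      if α ≠ β ∧ α.SharesEndpoint β then 1 else 0, Finset.sum_add_distrib, ← Finset.mul_sum,
    Finset.sum_boole, Finset.sum_boole]
  push_cast
  ring

/-- Every disk family is encoded by a family of arcs in some `ℤ/q`. -/
theorem IsDiskFamily.exists_onGrid {r : ℕ} (hr : 0 < r) {c : ℝ} {I : Finset (Arc c)}
    (hI : IsDiskFamily r I) : ∃ (q : ℤ) (pos : ℤ → ℝ) (z w : Arc c → ℤ), IsGrid c q pos ∧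
      (∀ α ∈ I, α.OnGrid pos (z α) (w α)) ∧
      CyclicFamily.IsFamily q r I z (fun α => w α - z α) := by
  classical
  obtain ⟨hc, huniv, hcov, -⟩ := hI
  have hne : I.Nonempty := by
    rw [Finset.nonempty_iff_ne_empty]
    rintro rfl
    have := hcov 0 (by simp)
    simp at this
    omega
  obtain ⟨q, pos, h, hpos⟩ := exists_isGrid hc (I.image Arc.a ∪ I.image Arc.b)
    ((hne.image _).mono Finset.subset_union_left)
  have hzw : ∀ α : Arc c, ∃ z w : ℤ, α ∈ I → α.OnGrid pos z w := by
    intro α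
    by_cases hα : α ∈ I
    · obtain ⟨z, hz⟩ := hpos α.a (Finset.mem_union_left _ (Finset.mem_image_of_mem _ hα))
      obtain ⟨w, hw⟩ := hpos α.b (Finset.mem_union_right _ (Finset.mem_image_of_mem _ hα))
      exact ⟨z, w, fun _ => ⟨hz, hw⟩⟩
    · exact ⟨0, 0, fun h => absurd h hα⟩
  choose z w hzw using hzw
  refine ⟨q, pos, z, w, h, hzw, h.period_pos hc, fun α hα => sub_pos.2 ((hzw α hα).lt h),
    fun x => ?_, fun α hα β hβ => ?_⟩
  · have h0 : pos x < pos (x + 1) := h.strictMono (by omega)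
    have h1 : pos x < (pos x + pos (x + 1)) / 2 := by linarith
    have h2 : (pos x + pos (x + 1)) / 2 < pos (x + 1) := by linarith
    have := hcov (((pos x + pos (x + 1)) / 2 : ℝ) : AddCircle c)
      fun α hα => (hzw α hα).not_mem_endpoints_of_cell h h1 h2
    rw [← this, Nat.subtype_card (I.filter fun α => (x - z α) % q < w α - z α)]
    · unfold CyclicFamily.cov
      rw [Finset.sum_boole]
    · intro α
      rw [Finset.mem_filter]
      exact and_congr_right fun hα => ((hzw α hα).mem_iff_of_cell h hc h1 h2).symm
  · obtain ⟨p, hp⟩ := (Set.ne_univ_iff_exists_notMem _).1 (huniv α hα β hβ)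
    obtain ⟨y, rfl⟩ := QuotientAddGroup.mk_surjective p
    obtain ⟨x, hx1, hx2⟩ := h.exists_cell hc y
    rw [Set.mem_union, not_or] at hp
    refine ⟨x, ?_, ?_⟩
    · by_contra! hlt
      exact hp.1 ((hzw α hα).mem_of_cell h hc hx1 hx2 hlt)
    · by_contra! hlt
      exact hp.2 ((hzw β hβ).mem_of_cell h hc hx1 hx2 hlt)

/-- **Discrete area lower bound** (Theorem 5.2/9.1 of the paper): every `r`-disk family,
on a circle of any circumference, has area at least `(3/2)·r²`. -/
theorem diskArea_ge (r : ℕ) (hr : 0 < r) {c : ℝ} (I : Finset (Arc c))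
    (hI : IsDiskFamily r I) :
    (3 / 2 : ℝ) * (r : ℝ) ^ 2 ≤ diskArea I := by
  classical
  obtain ⟨q, pos, z, w, h, hg, hfam⟩ := hI.exists_onGrid hr
  have hc := hI.1
  have key : 2 * CyclicFamily.weight q I z (fun α => w α - z α) ≤
      ∑ α ∈ I, ∑ β ∈ I, (2 * (if α.Crosses β then 1 else 0) +
        if α ≠ β ∧ α.SharesEndpoint β then 1 else 0) := by
    unfold CyclicFamily.weight
    rw [two_mul]
    conv_lhs =>
      arg 2
      rw [Finset.sum_comm]
    rw [← Finset.sum_add_distrib]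
    refine Finset.sum_le_sum fun α hα => ?_
    rw [← Finset.sum_add_distrib]
    refine Finset.sum_le_sum fun β hβ => ?_
    have n1 := hfam.not_cover hα hβ
    have n2 := hfam.not_cover hβ hα
    have h1 := (hg α hα).wt_le (hg β hβ) h hc n1
    have h2 := (hg β hβ).wt_le (hg α hα) h hc n2
    have e1 : β.Crosses α ↔ α.Crosses β := ⟨fun h => h.symm, fun h => h.symm⟩
    have e2 : β ≠ α ∧ β.SharesEndpoint α ↔ α ≠ β ∧ α.SharesEndpoint β :=
      ⟨fun h => ⟨h.1.symm, h.2.symm⟩, fun h => ⟨h.1.symm, h.2.symm⟩⟩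
    simp only [e1, e2] at h2
    rcases (hg α hα).wt_eq_zero_or_wt_eq_zero (hg β hβ) h hc n2 with h0 | h0 <;>
      rw [h0] <;> linarith
  have hmain : 3 * (r : ℝ) ^ 2 ≤ CyclicFamily.weight q I z (fun α => w α - z α) := by
    exact_mod_cast hfam.three_mul_sq_le
  have hkey := (Int.cast_le (R := ℝ)).2 key
  rw [← four_mul_diskArea] at hkey
  push_cast at hkey
  linarith
end
end

section
/- Let 𝕀 be an area-minimal r-disk family. Then 𝕀 contains an arc whose interior contains no endpoint of any arc of 𝕀. -/
noncomputable section

section Endpoints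

variable {c : ℝ}

lemma Arc.init_mem_toSet (x : Arc c) : x.init ∈ x.toSet :=
  ⟨x.a, ⟨le_rfl, by have := x.width_pos; linarith⟩, rfl⟩

lemma Arc.term_mem_toSet (x : Arc c) : x.term ∈ x.toSet :=
  ⟨x.b, ⟨by have := x.width_pos; linarith, le_rfl⟩, rfl⟩

lemma Arc.mem_toSet_and_ne_of_mem_interiorSet {x : Arc c} {q : AddCircle c}
    (hq : q ∈ x.interiorSet) : q ∈ x.toSet ∧ q ≠ x.init ∧ q ≠ x.term := by
  obtain ⟨z, ⟨hz1, hz2⟩, rfl⟩ := hq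
  have hw := x.width_pos
  have hw' := x.width_lt
  have : Fact (0 < c) := ⟨hw.trans hw'⟩
  have hz : z ∈ Set.Ico x.a (x.a + c) := ⟨hz1.le, by linarith⟩
  refine ⟨⟨z, ⟨hz1.le, hz2.le⟩, rfl⟩, fun h => ?_, fun h => ?_⟩
  · exact hz1.ne' ((AddCircle.coe_eq_coe_iff_of_mem_Ico hz ⟨le_rfl, by linarith⟩).1 h)
  · exact hz2.ne ((AddCircle.coe_eq_coe_iff_of_mem_Ico hz ⟨by linarith, by linarith⟩).1 h)

end Endpoints

section Position

variable {c : ℝ} [hc : Fact (0 < c)]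

/-- The representative of a point of `ℝ/cℤ` in `[e, e + c)`. -/
def circlePos (e : ℝ) (q : AddCircle c) : ℝ := (AddCircle.equivIco c e q : ℝ)

lemma le_circlePos (e : ℝ) (q : AddCircle c) : e ≤ circlePos e q :=
  (AddCircle.equivIco c e q).2.1

lemma circlePos_lt (e : ℝ) (q : AddCircle c) : circlePos e q < e + c :=
  (AddCircle.equivIco c e q).2.2

lemma coe_circlePos (e : ℝ) (q : AddCircle c) : (circlePos e q : AddCircle c) = q :=
  (AddCircle.equivIco c e).symm_apply_apply q

lemma circlePos_coe {e x : ℝ} (h₁ : e ≤ x) (h₂ : x < e + c) :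
    circlePos e (x : AddCircle c) = x := by
  have := (AddCircle.equivIco c e).apply_symm_apply ⟨x, h₁, h₂⟩
  exact congrArg Subtype.val this

lemma circlePos_inj {e : ℝ} {q q' : AddCircle c} :
    circlePos e q = circlePos e q' ↔ q = q' := by
  rw [circlePos, circlePos, Subtype.coe_inj, (AddCircle.equivIco c e).injective.eq_iff]

lemma exists_eq_circlePos_add (e x : ℝ) :
    ∃ k : ℤ, x = circlePos e (x : AddCircle c) + k * c := by
  have h : ((x - circlePos e (x : AddCircle c) : ℝ) : AddCircle c) = 0 := by
    rw [AddCircle.coe_sub, coe_circlePos, sub_self]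
  obtain ⟨k, hk⟩ := (AddCircle.coe_eq_zero_iff c).1 h
  exact ⟨k, by rw [← zsmul_eq_mul, hk]; ring⟩

/-- Membership in the cyclic interval from `s` to `u`. -/
def CyclicMem (s u z : ℝ) : Prop := (s < u ∧ s ≤ z ∧ z ≤ u) ∨ (u < s ∧ (s ≤ z ∨ z ≤ u))

/-- The position of the initial endpoint of an arc in `[e, e + c)`. -/
def Arc.initPos (e : ℝ) (x : Arc c) : ℝ := circlePos e x.init

/-- The position of the terminal endpoint of an arc in `[e, e + c)`. -/
def Arc.termPos (e : ℝ) (x : Arc c) : ℝ := circlePos e x.term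

lemma Arc.positions_cases (e : ℝ) (x : Arc c) : ∃ k : ℤ, x.a = x.initPos e + k * c ∧
    ((x.initPos e < x.termPos e ∧ x.b = x.termPos e + k * c) ∨
      (x.termPos e < x.initPos e ∧ x.b = x.termPos e + c + k * c)) := by
  obtain ⟨k, hk⟩ := exists_eq_circlePos_add (c := c) e x.a
  obtain ⟨m, hm⟩ := exists_eq_circlePos_add (c := c) e x.b
  have hs := le_circlePos e x.init
  have hs' := circlePos_lt e x.init
  have hu := le_circlePos e x.term
  have hu' := circlePos_lt e x.term
  have hw := x.width_pos
  have hw' := x.width_lt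
  have c0 := hc.out
  change x.a = x.initPos e + k * c at hk
  change x.b = x.termPos e + m * c at hm
  change e ≤ x.initPos e at hs
  change x.initPos e < e + c at hs'
  change e ≤ x.termPos e at hu
  change x.termPos e < e + c at hu'
  have h1 : -1 < m - k := by
    have : (-1 : ℝ) < ((m - k : ℤ) : ℝ) := by push_cast; nlinarith
    exact_mod_cast this
  have h2 : m - k < 2 := by
    have : ((m - k : ℤ) : ℝ) < (2 : ℝ) := by push_cast; nlinarith
    exact_mod_cast this
  refine ⟨k, hk, ?_⟩
  obtain h | h : m = k ∨ m = k + 1 := by omega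
  · subst h
    exact Or.inl ⟨by linarith, hm⟩
  · subst h
    push_cast at hm
    exact Or.inr ⟨by linarith, by linarith⟩

lemma Arc.mem_toSet_iff (e : ℝ) (x : Arc c) (q : AddCircle c) :
    q ∈ x.toSet ↔ CyclicMem (x.initPos e) (x.termPos e) (circlePos e q) := by
  obtain ⟨k, hk, hx⟩ := x.positions_cases e
  have hs : e ≤ x.initPos e := le_circlePos e x.init
  have hs' : x.initPos e < e + c := circlePos_lt e x.init
  have hu : e ≤ x.termPos e := le_circlePos e x.term
  have hu' : x.termPos e < e + c := circlePos_lt e x.term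
  have hq := le_circlePos e q
  have hq' := circlePos_lt e q
  have c0 := hc.out
  constructor
  · rintro ⟨z, ⟨hz1, hz2⟩, rfl⟩
    simp only at hq hq' ⊢
    obtain ⟨l, hl⟩ := exists_eq_circlePos_add (c := c) e z
    have h1 : -1 < l - k := by
      have : (-1 : ℝ) < ((l - k : ℤ) : ℝ) := by push_cast; nlinarith
      exact_mod_cast this
    have h2 : l - k < 2 := by
      have : ((l - k : ℤ) : ℝ) < (2 : ℝ) := by
        push_cast
        rcases hx with ⟨_, hx⟩ | ⟨_, hx⟩ <;> nlinarith
      exact_mod_cast this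
    obtain h | h : l = k ∨ l = k + 1 := by omega
    · subst h
      rcases hx with ⟨h, hx⟩ | ⟨h, hx⟩
      · exact Or.inl ⟨h, by linarith, by linarith⟩
      · exact Or.inr ⟨h, Or.inl (by linarith)⟩
    · subst h
      push_cast at hl
      rcases hx with ⟨h, hx⟩ | ⟨h, hx⟩
      · exfalso; linarith
      · exact Or.inr ⟨h, Or.inr (by linarith)⟩
  · have hcoe : ∀ m : ℤ, ((circlePos e q + m * c : ℝ) : AddCircle c) = q := by
      intro m
      rw [AddCircle.coe_add, coe_circlePos, ← zsmul_eq_mul, AddCircle.coe_zsmul,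
        AddCircle.coe_period, smul_zero, add_zero]
    rintro (⟨h, h1, h2⟩ | ⟨h, h1 | h1⟩)
    · refine ⟨circlePos e q + k * c, ⟨?_, ?_⟩, hcoe k⟩ <;>
        rcases hx with ⟨h, hx⟩ | ⟨h, hx⟩ <;> linarith
    · refine ⟨circlePos e q + k * c, ⟨?_, ?_⟩, hcoe k⟩ <;>
        rcases hx with ⟨h, hx⟩ | ⟨h, hx⟩ <;> linarith
    · refine ⟨circlePos e q + (k + 1 : ℤ) * c, ⟨?_, ?_⟩, hcoe _⟩ <;> push_cast <;>
        rcases hx with ⟨h, hx⟩ | ⟨h, hx⟩ <;> linarith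

lemma Arc.initPos_ne_termPos (e : ℝ) (x : Arc c) : x.initPos e ≠ x.termPos e := by
  obtain ⟨k, -, h | h⟩ := x.positions_cases e
  · exact h.1.ne
  · exact h.1.ne'

lemma Arc.mem_endpoints_iff (e : ℝ) (x : Arc c) (q : AddCircle c) : q ∈ x.endpoints ↔
    circlePos e q = x.initPos e ∨ circlePos e q = x.termPos e := by
  simp only [Arc.initPos, Arc.termPos, circlePos_inj]; rfl

lemma Arc.width_eq_of_lt {e : ℝ} {x : Arc c} (h : x.initPos e < x.termPos e) :
    x.width = x.termPos e - x.initPos e := by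
  obtain ⟨k, hk, hx | hx⟩ := x.positions_cases e
  · rw [Arc.width, hk, hx.2]; ring
  · exact absurd hx.1 h.not_gt

lemma Arc.width_eq_of_gt {e : ℝ} {x : Arc c} (h : x.termPos e < x.initPos e) :
    x.width = x.termPos e + c - x.initPos e := by
  obtain ⟨k, hk, hx | hx⟩ := x.positions_cases e
  · exact absurd hx.1 h.not_gt
  · rw [Arc.width, hk, hx.2]; ring

lemma Arc.sharesEndpoint_iff (e : ℝ) (x y : Arc c) : x.SharesEndpoint y ↔
    x.initPos e = y.initPos e ∨ x.initPos e = y.termPos e ∨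
      x.termPos e = y.initPos e ∨ x.termPos e = y.termPos e := by
  simp only [Arc.initPos, Arc.termPos, circlePos_inj]
  constructor
  · rintro ⟨q, h | h, h' | h'⟩ <;> simp_all
  · rintro (h | h | h | h)
    · exact ⟨x.init, Or.inl rfl, Or.inl h⟩
    · exact ⟨x.init, Or.inl rfl, Or.inr h⟩
    · exact ⟨x.term, Or.inr rfl, Or.inl h⟩
    · exact ⟨x.term, Or.inr rfl, Or.inr h⟩

lemma Arc.crosses_iff (e : ℝ) {x : Arc c} (hx : x.initPos e < x.termPos e) (y : Arc c) :
    x.Crosses y ↔ ¬ x.SharesEndpoint y ∧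
      Xor (x.initPos e ≤ y.initPos e ∧ y.initPos e ≤ x.termPos e)
        (x.initPos e ≤ y.termPos e ∧ y.termPos e ≤ x.termPos e) := by
  unfold Arc.Crosses
  refine and_congr_right fun h => ?_
  rw [Arc.sharesEndpoint_iff e] at h
  have hy := y.initPos_ne_termPos e
  have hi : ∀ z : Arc c, circlePos e z.init = z.initPos e := fun _ => rfl
  have ht : ∀ z : Arc c, circlePos e z.term = z.termPos e := fun _ => rfl
  simp only [Arc.mem_toSet_iff e, CyclicMem, Xor', xor_def, hi, ht]
  generalize x.initPos e = s at *
  generalize x.termPos e = u at *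
  generalize y.initPos e = s' at *
  generalize y.termPos e = u' at *
  grind

end Position

section Counting

open Classical in
lemma card_mem_and_eq_sum {A : Type*} (I : Finset A) (P : A → Prop) :
    Nat.card {x : A // x ∈ I ∧ P x} = ∑ x ∈ I, if P x then 1 else 0 := by
  rw [← Finset.card_filter, Nat.subtype_card (I.filter P)]
  simp

open Classical in
lemma card_pair_mem_and_eq_sum {A : Type*} (I : Finset A) (P : A → A → Prop) :
    Nat.card {p : A × A // p.1 ∈ I ∧ p.2 ∈ I ∧ P p.1 p.2} =
      ∑ x ∈ I, ∑ y ∈ I, if P x y then 1 else 0 := by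
  rw [← Finset.sum_product', ← Finset.card_filter,
    Nat.subtype_card ((I ×ˢ I).filter fun p => P p.1 p.2)]
  simp [and_assoc]

variable {c : ℝ}

open Classical in
/-- The contribution of an ordered pair of arcs to the area. -/
def pairWeight (x y : Arc c) : ℝ :=
  if x.Crosses y then 1 / 2 else if x ≠ y ∧ x.SharesEndpoint y then 1 / 4 else 0

lemma diskArea_eq_sum (I : Finset (Arc c)) :
    diskArea I = ∑ x ∈ I, ∑ y ∈ I, pairWeight x y := by
  classical
  rw [diskArea, card_pair_mem_and_eq_sum I Arc.Crosses,
    card_pair_mem_and_eq_sum I fun x y => x ≠ y ∧ x.SharesEndpoint y]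
  push_cast
  simp only [Finset.sum_div, ← Finset.sum_add_distrib]
  refine Finset.sum_congr rfl fun x _ => Finset.sum_congr rfl fun y _ => ?_
  unfold pairWeight
  by_cases h : x.Crosses y
  · simp [h, h.1]
  · simp only [h, if_false]
    split_ifs <;> norm_num

lemma pairWeight_self (x : Arc c) : pairWeight x x = 0 := by
  have h : x.SharesEndpoint x := ⟨x.init, Or.inl rfl, Or.inl rfl⟩
  have h' : ¬ x.Crosses x := fun h' => h'.1 h
  simp [pairWeight, h']

lemma pairWeight_comm (x y : Arc c) : pairWeight x y = pairWeight y x := by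
  have h : x.SharesEndpoint y ↔ y.SharesEndpoint x := by
    unfold Arc.SharesEndpoint; rw [Set.inter_comm]
  have h' : x.Crosses y ↔ y.Crosses x := by
    unfold Arc.Crosses; rw [h, or_comm]
  have h'' : x ≠ y ↔ y ≠ x := ne_comm
  unfold pairWeight
  split_ifs <;> tauto

open Classical in
/-- The contribution to the area of an arc at positions `x₀ < x₁` and a different arc at
positions `s`, `u`. -/
def positionWeight (x₀ x₁ s u : ℝ) : ℝ :=
  if x₀ = s ∨ x₀ = u ∨ x₁ = s ∨ x₁ = u then 1 / 4
  else if Xor (x₀ ≤ s ∧ s ≤ x₁) (x₀ ≤ u ∧ u ≤ x₁) then 1 / 2 else 0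

lemma pairWeight_eq_positionWeight [Fact (0 < c)] (e : ℝ) {x y : Arc c}
    (hx : x.initPos e < x.termPos e) (hxy : x ≠ y) :
    pairWeight x y =
      positionWeight (x.initPos e) (x.termPos e) (y.initPos e) (y.termPos e) := by
  have hc := Arc.crosses_iff e hx y
  have hs := Arc.sharesEndpoint_iff e x y
  unfold pairWeight positionWeight
  split_ifs <;> tauto

lemma positionWeight_split_le {e a p p' b s u : ℝ} (h₁ : a < p) (h₂ : p < p')
    (h₃ : p' < b) (hs : e < s) (hu : e ≤ u) (hsa : s ≠ a) (hup : u ≠ p) (hub : u ≠ b)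
    (hsp : ¬ (p < s ∧ s ≤ p')) (hup' : ¬ (p < u ∧ u ≤ p'))
    (hsu : a ≤ s → s ≤ b → a ≤ u → u ≤ b → False) (hp : s = p → p < u) :
    positionWeight e p' s u + positionWeight a p s u + positionWeight p' b s u ≤
      positionWeight e p s u + positionWeight a b s u := by
  by_cases h : s = p
  · subst h
    unfold positionWeight; simp only [xor_def]
    grind
  · have e1 : positionWeight e p' s u = positionWeight e p s u := by
      unfold positionWeight; simp only [xor_def]; grind
    have e2 : positionWeight a p s u + positionWeight p' b s u = positionWeight a b s u := by
      unfold positionWeight; simp only [xor_def]; grind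
    linarith

end Counting

section DiskFamily

variable {r : ℕ} {c : ℝ} {I : Finset (Arc c)}

lemma IsDiskFamily.eq_of_init_eq (hI : IsDiskFamily r I) {x y : Arc c} (hx : x ∈ I) (hy : y ∈ I)
    (h : x.init = y.init) : x = y := by
  have h1 := (hI.2.2.2 y.init ⟨y, hy, Or.inl rfl⟩).2.1
  have := (Nat.card_eq_one_iff_unique.1 h1).1
  exact congrArg Subtype.val (this.elim ⟨x, hx, h⟩ ⟨y, hy, rfl⟩)

lemma IsDiskFamily.eq_of_term_eq (hI : IsDiskFamily r I) {x y : Arc c} (hx : x ∈ I) (hy : y ∈ I)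
    (h : x.term = y.term) : x = y := by
  have h1 := (hI.2.2.2 y.term ⟨y, hy, Or.inr rfl⟩).1
  have := (Nat.card_eq_one_iff_unique.1 h1).1
  exact congrArg Subtype.val (this.elim ⟨x, hx, h⟩ ⟨y, hy, rfl⟩)

lemma IsDiskFamily.exists_term_eq (hI : IsDiskFamily r I) {q : AddCircle c}
    (hq : ∃ x ∈ I, q ∈ x.endpoints) : ∃ x ∈ I, x.term = q := by
  obtain ⟨⟨x, hx⟩⟩ := (Nat.card_eq_one_iff_unique.1 (hI.2.2.2 q hq).1).2
  exact ⟨x, hx⟩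

lemma IsDiskFamily.nonempty (hI : IsDiskFamily r I) (hr : 0 < r) : I.Nonempty := by
  by_contra h
  rw [Finset.not_nonempty_iff_eq_empty] at h
  subst h
  have := hI.2.2.1 0 (by simp)
  simp at this
  omega

lemma IsDiskFamily.inter_eq (hI : IsDiskFamily r I) {x y : Arc c} (hx : x ∈ I) (hy : y ∈ I)
    (h : x.term = y.init) : x.toSet ∩ y.toSet = {x.term} :=
  (hI.2.2.2 x.term ⟨x, hx, Or.inr rfl⟩).2.2 x hx y hy rfl h.symm

end DiskFamily

section Surgery

variable {c : ℝ} [hc : Fact (0 < c)]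

/-- An arc `short` of a family together with an arc `left` ending at a point `p` in its
interior and starting before it, and points `p'`, `p''` following `p` such that no endpoint
lies in `(p, p'']`. Positions are taken in `[e, e + c)`, where `e` is the starting point of
`left`. -/
structure SplitData (I : Finset (Arc c)) where
  left : Arc c
  short : Arc c
  e : ℝ
  a : ℝ
  p : ℝ
  p' : ℝ
  p'' : ℝ
  b : ℝ
  left_mem : left ∈ I
  short_mem : short ∈ I
  e_lt_a : e < a
  a_lt_p : a < p
  p_lt_p' : p < p'
  p'_lt_p'' : p' < p''
  p''_lt_b : p'' < b
  b_lt : b < e + c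
  left_init : left.initPos e = e
  left_term : left.termPos e = p
  short_init : short.initPos e = a
  short_term : short.termPos e = b
  init_notMem : ∀ x ∈ I, ¬ (p < x.initPos e ∧ x.initPos e ≤ p'')
  term_notMem : ∀ x ∈ I, ¬ (p < x.termPos e ∧ x.termPos e ≤ p'')
  not_both : ∀ x ∈ I, x ≠ short → a ≤ x.initPos e → x.initPos e ≤ b →
    a ≤ x.termPos e → x.termPos e ≤ b → False

namespace SplitData

variable {r : ℕ} {I : Finset (Arc c)} (D : SplitData I)

/-- The arc `left` prolonged to end at `p'`. -/
def newLeft : Arc c where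
  a := D.e
  b := D.p'
  width_pos := by have := D.e_lt_a; have := D.a_lt_p; have := D.p_lt_p'; linarith
  width_lt := by have := D.p'_lt_p''; have := D.p''_lt_b; have := D.b_lt; linarith

/-- The part of `short` before `p`. -/
def firstHalf : Arc c where
  a := D.a
  b := D.p
  width_pos := by have := D.a_lt_p; linarith
  width_lt := by
    have := D.e_lt_a; have := D.p_lt_p'; have := D.p'_lt_p''; have := D.p''_lt_b
    have := D.b_lt; linarith

/-- The part of `short` after `p'`. -/
def secondHalf : Arc c where
  a := D.p'
  b := D.b
  width_pos := by have := D.p'_lt_p''; have := D.p''_lt_b; linarith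
  width_lt := by
    have := D.e_lt_a; have := D.a_lt_p; have := D.p_lt_p'; have := D.b_lt; linarith

lemma order : D.e < D.a ∧ D.a < D.p ∧ D.p < D.p' ∧ D.p' < D.p'' ∧ D.p'' < D.b ∧
    D.b < D.e + c :=
  ⟨D.e_lt_a, D.a_lt_p, D.p_lt_p', D.p'_lt_p'', D.p''_lt_b, D.b_lt⟩

lemma newLeft_init : D.newLeft.initPos D.e = D.e :=
  circlePos_coe le_rfl (lt_add_of_pos_right _ hc.out)

lemma newLeft_term : D.newLeft.termPos D.e = D.p' := by
  obtain ⟨h1, h2, h3, h4, h5, h6⟩ := D.order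
  exact circlePos_coe (show D.e ≤ D.p' by linarith) (show D.p' < D.e + c by linarith)

lemma firstHalf_init : D.firstHalf.initPos D.e = D.a := by
  obtain ⟨h1, h2, h3, h4, h5, h6⟩ := D.order
  exact circlePos_coe (show D.e ≤ D.a by linarith) (show D.a < D.e + c by linarith)

lemma firstHalf_term : D.firstHalf.termPos D.e = D.p := by
  obtain ⟨h1, h2, h3, h4, h5, h6⟩ := D.order
  exact circlePos_coe (show D.e ≤ D.p by linarith) (show D.p < D.e + c by linarith)

lemma secondHalf_init : D.secondHalf.initPos D.e = D.p' := by
  obtain ⟨h1, h2, h3, h4, h5, h6⟩ := D.order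
  exact circlePos_coe (show D.e ≤ D.p' by linarith) (show D.p' < D.e + c by linarith)

lemma secondHalf_term : D.secondHalf.termPos D.e = D.b := by
  obtain ⟨h1, h2, h3, h4, h5, h6⟩ := D.order
  exact circlePos_coe (show D.e ≤ D.b by linarith) (show D.b < D.e + c by linarith)

open Classical in
/-- The arcs of the family other than `left` and `short`. -/
def rest : Finset (Arc c) := (I.erase D.left).erase D.short

open Classical in
/-- The family obtained by replacing `left` and `short` by the three new arcs. -/
def newFamily : Finset (Arc c) :=
  insert D.newLeft (insert D.firstHalf (insert D.secondHalf D.rest))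

lemma left_ne_short : D.left ≠ D.short := fun h => by
  have h1 := D.left_init
  rw [h, D.short_init] at h1
  exact D.e_lt_a.ne' h1

lemma mem_rest {x : Arc c} : x ∈ D.rest ↔ x ∈ I ∧ x ≠ D.left ∧ x ≠ D.short := by
  simp only [rest, Finset.mem_erase]; tauto

lemma mem_newFamily {x : Arc c} : x ∈ D.newFamily ↔
    x = D.newLeft ∨ x = D.firstHalf ∨ x = D.secondHalf ∨ x ∈ D.rest := by
  simp [newFamily]

lemma sum_eq {M : Type*} [AddCommMonoid M] (g : Arc c → M) :
    ∑ x ∈ I, g x = g D.left + (g D.short + ∑ x ∈ D.rest, g x) := by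
  classical
  rw [← Finset.add_sum_erase I g D.left_mem, ← Finset.add_sum_erase (I.erase D.left) g
    (Finset.mem_erase.2 ⟨D.left_ne_short.symm, D.short_mem⟩)]
  rfl

lemma init_ne_of_mem_rest (hI : IsDiskFamily r I) {x : Arc c} (hx : x ∈ D.rest) :
    x.initPos D.e ≠ D.e ∧ x.initPos D.e ≠ D.a := by
  obtain ⟨hx, h1, h2⟩ := D.mem_rest.1 hx
  constructor
  · exact fun h => h1 (hI.eq_of_init_eq hx D.left_mem
      (circlePos_inj.1 (h.trans D.left_init.symm)))
  · exact fun h => h2 (hI.eq_of_init_eq hx D.short_mem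
      (circlePos_inj.1 (h.trans D.short_init.symm)))

lemma term_ne_of_mem_rest (hI : IsDiskFamily r I) {x : Arc c} (hx : x ∈ D.rest) :
    x.termPos D.e ≠ D.p ∧ x.termPos D.e ≠ D.b := by
  obtain ⟨hx, h1, h2⟩ := D.mem_rest.1 hx
  constructor
  · exact fun h => h1 (hI.eq_of_term_eq hx D.left_mem
      (circlePos_inj.1 (h.trans D.left_term.symm)))
  · exact fun h => h2 (hI.eq_of_term_eq hx D.short_mem
      (circlePos_inj.1 (h.trans D.short_term.symm)))

lemma sum_newFamily (hI : IsDiskFamily r I) {M : Type*} [AddCommMonoid M] (g : Arc c → M) :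
    ∑ x ∈ D.newFamily, g x =
      g D.newLeft + (g D.firstHalf + (g D.secondHalf + ∑ x ∈ D.rest, g x)) := by
  classical
  obtain ⟨h1, h2, h3, h4, h5, h6⟩ := D.order
  have hA : D.newLeft ∉ D.rest := fun h => (D.init_ne_of_mem_rest hI h).1 D.newLeft_init
  have hB : D.firstHalf ∉ D.rest := fun h => (D.init_ne_of_mem_rest hI h).2 D.firstHalf_init
  have hC : D.secondHalf ∉ D.rest := fun h =>
    D.init_notMem _ (D.mem_rest.1 h).1 (by rw [D.secondHalf_init]; exact ⟨h3, h4.le⟩)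
  have hAB : D.newLeft ≠ D.firstHalf := fun h => h1.ne (congrArg Arc.a h)
  have hAC : D.newLeft ≠ D.secondHalf := fun h => (h1.trans (h2.trans h3)).ne (congrArg Arc.a h)
  have hBC : D.firstHalf ≠ D.secondHalf := fun h => (h2.trans h3).ne (congrArg Arc.a h)
  rw [newFamily, Finset.sum_insert (by simp [hAB, hAC, hA]),
    Finset.sum_insert (by simp [hBC, hB]), Finset.sum_insert hC]

lemma mem_newLeft {q : AddCircle c} : q ∈ D.newLeft.toSet ↔ circlePos D.e q ≤ D.p' := by
  obtain ⟨h1, h2, h3, h4, h5, h6⟩ := D.order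
  have := le_circlePos D.e q
  rw [Arc.mem_toSet_iff D.e, newLeft_init, newLeft_term, CyclicMem]
  grind

lemma mem_left {q : AddCircle c} : q ∈ D.left.toSet ↔ circlePos D.e q ≤ D.p := by
  obtain ⟨h1, h2, h3, h4, h5, h6⟩ := D.order
  have := le_circlePos D.e q
  rw [Arc.mem_toSet_iff D.e, left_init, left_term, CyclicMem]
  grind

lemma mem_short {q : AddCircle c} :
    q ∈ D.short.toSet ↔ D.a ≤ circlePos D.e q ∧ circlePos D.e q ≤ D.b := by
  obtain ⟨h1, h2, h3, h4, h5, h6⟩ := D.order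
  rw [Arc.mem_toSet_iff D.e, short_init, short_term, CyclicMem]
  grind

lemma mem_firstHalf {q : AddCircle c} :
    q ∈ D.firstHalf.toSet ↔ D.a ≤ circlePos D.e q ∧ circlePos D.e q ≤ D.p := by
  obtain ⟨h1, h2, h3, h4, h5, h6⟩ := D.order
  rw [Arc.mem_toSet_iff D.e, firstHalf_init, firstHalf_term, CyclicMem]
  grind

lemma mem_secondHalf {q : AddCircle c} :
    q ∈ D.secondHalf.toSet ↔ D.p' ≤ circlePos D.e q ∧ circlePos D.e q ≤ D.b := by
  obtain ⟨h1, h2, h3, h4, h5, h6⟩ := D.order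
  rw [Arc.mem_toSet_iff D.e, secondHalf_init, secondHalf_term, CyclicMem]
  grind

lemma mem_toSet_of_le {x : Arc c} (hx : x ∈ I) {q q' : AddCircle c} (hq : q ∈ x.toSet)
    (h₁ : D.p ≤ circlePos D.e q') (h₂ : circlePos D.e q' ≤ circlePos D.e q)
    (h₃ : circlePos D.e q ≤ D.p'') : q' ∈ x.toSet := by
  have h4 := D.init_notMem x hx
  rw [Arc.mem_toSet_iff D.e, CyclicMem] at hq ⊢
  grind

lemma union_ne_univ (hI : IsDiskFamily r I) {x y : Arc c} (hx : x ∈ D.newFamily)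
    (hy : y ∈ D.newFamily) : x.toSet ∪ y.toSet ≠ Set.univ := by
  obtain ⟨h1, h2, h3, h4, h5, h6⟩ := D.order
  have hsub : ∀ z ∈ D.newFamily, z ≠ D.newLeft → ∃ z' ∈ I, z.toSet ⊆ z'.toSet := by
    intro z hz hne
    rcases D.mem_newFamily.1 hz with rfl | rfl | rfl | hz
    · exact absurd rfl hne
    · exact ⟨D.short, D.short_mem, fun q hq => by rw [mem_firstHalf] at hq; rw [mem_short]; grind⟩
    · exact ⟨D.short, D.short_mem, fun q hq => by rw [mem_secondHalf] at hq; rw [mem_short]; grind⟩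
    · exact ⟨z, (D.mem_rest.1 hz).1, subset_rfl⟩
  have hfar : circlePos D.e (((D.b + D.e + c) / 2 : ℝ) : AddCircle c) = (D.b + D.e + c) / 2 :=
    circlePos_coe (by linarith) (by linarith)
  have hnear : circlePos D.e ((D.p'' : ℝ) : AddCircle c) = D.p'' :=
    circlePos_coe (by linarith) (by linarith)
  have hleft : ∀ z ∈ D.newFamily, D.newLeft.toSet ∪ z.toSet ≠ Set.univ := by
    intro z hz h
    have hfar' := h.symm ▸ Set.mem_univ (((D.b + D.e + c) / 2 : ℝ) : AddCircle c)
    rw [Set.mem_union, mem_newLeft, hfar] at hfar'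
    rcases D.mem_newFamily.1 hz with rfl | rfl | rfl | hz
    · rw [mem_newLeft, hfar] at hfar'; grind
    · rw [mem_firstHalf, hfar] at hfar'; grind
    · rw [mem_secondHalf, hfar] at hfar'; grind
    · have hzI := (D.mem_rest.1 hz).1
      refine hI.2.1 _ D.left_mem z hzI (Set.eq_univ_of_forall fun q => ?_)
      rw [Set.mem_union, mem_left]
      by_cases hqp : circlePos D.e q ≤ D.p
      · exact Or.inl hqp
      right
      by_cases hqp' : circlePos D.e q ≤ D.p'
      · have hn := h.symm ▸ Set.mem_univ ((D.p'' : ℝ) : AddCircle c)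
        rw [Set.mem_union, mem_newLeft, hnear] at hn
        exact D.mem_toSet_of_le hzI (hn.resolve_left h4.not_ge) (by linarith) (by linarith)
          hnear.le
      · have hq := h.symm ▸ Set.mem_univ q
        rw [Set.mem_union, mem_newLeft] at hq
        exact hq.resolve_left hqp'
  by_cases hxl : x = D.newLeft
  · subst hxl; exact hleft y hy
  by_cases hyl : y = D.newLeft
  · subst hyl; rw [Set.union_comm]; exact hleft x hx
  obtain ⟨x', hx', hxx⟩ := hsub x hx hxl
  obtain ⟨y', hy', hyy⟩ := hsub y hy hyl
  exact fun h => hI.2.1 x' hx' y' hy' (Set.univ_subset_iff.1 (h ▸ Set.union_subset_union hxx hyy))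

lemma inter_eq_singleton (hI : IsDiskFamily r I) {x y : Arc c} (hx : x ∈ D.newFamily)
    (hy : y ∈ D.newFamily) (hxy : x.term = y.init) : x.toSet ∩ y.toSet = {x.term} := by
  obtain ⟨h1, h2, h3, h4, h5, h6⟩ := D.order
  have hpos : x.termPos D.e = y.initPos D.e := circlePos_inj.2 hxy
  have hsub : x.toSet ∩ y.toSet ⊆ {x.term} := by
    have hX : x = D.newLeft ∨
        (x.termPos D.e ≠ D.p' ∧ ∃ x' ∈ I, x.toSet ⊆ x'.toSet ∧ x'.term = x.term) := by
      rcases D.mem_newFamily.1 hx with rfl | rfl | rfl | hx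
      · exact Or.inl rfl
      · refine Or.inr ⟨by rw [firstHalf_term]; exact h3.ne, D.left, D.left_mem, fun q hq => ?_,
          circlePos_inj.1 (D.left_term.trans D.firstHalf_term.symm)⟩
        rw [mem_firstHalf] at hq; rw [mem_left]; exact hq.2
      · refine Or.inr ⟨by rw [secondHalf_term]; linarith, D.short, D.short_mem, fun q hq => ?_,
          circlePos_inj.1 (D.short_term.trans D.secondHalf_term.symm)⟩
        rw [mem_secondHalf] at hq; rw [mem_short]; exact ⟨by linarith, hq.2⟩
      · have hxI := (D.mem_rest.1 hx).1
        exact Or.inr ⟨fun h => D.term_notMem x hxI (by rw [h]; exact ⟨h3, h4.le⟩),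
          x, hxI, subset_rfl, rfl⟩
    rcases hX with rfl | ⟨hxp, x', hx', hxx, hxt⟩
    · rw [newLeft_term] at hpos
      rcases D.mem_newFamily.1 hy with rfl | rfl | rfl | hy
      · rw [newLeft_init] at hpos; linarith
      · rw [firstHalf_init] at hpos; linarith
      · rintro q ⟨hq, hq'⟩
        rw [mem_newLeft] at hq
        rw [mem_secondHalf] at hq'
        exact circlePos_inj.1 ((le_antisymm hq hq'.1).trans D.newLeft_term.symm)
      · exact (D.init_notMem y (D.mem_rest.1 hy).1 (by rw [← hpos]; exact ⟨h3, h4.le⟩)).elim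
    · have key : ∀ y' ∈ I, y.toSet ⊆ y'.toSet → y'.init = y.init →
          x.toSet ∩ y.toSet ⊆ {x.term} := by
        intro y' hy' hyy hyi
        rw [← hxt, ← hI.inter_eq hx' hy' (by rw [hxt, hyi, hxy])]
        exact Set.inter_subset_inter hxx hyy
      rcases D.mem_newFamily.1 hy with rfl | rfl | rfl | hy
      · rintro q ⟨hq, hq'⟩
        have hinter := hI.inter_eq hx' D.left_mem
          (by rw [hxt, hxy]; exact circlePos_inj.1 (D.newLeft_init.trans D.left_init.symm))
        rw [← hxt, ← hinter]
        refine ⟨hxx hq, ?_⟩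
        rw [mem_newLeft] at hq'
        rw [mem_left]
        by_contra hqp
        rw [not_le] at hqp
        have hp : circlePos D.e ((D.p : ℝ) : AddCircle c) = D.p :=
          circlePos_coe (by linarith) (by linarith)
        have hmem : ((D.p : ℝ) : AddCircle c) ∈ x'.toSet ∩ D.left.toSet :=
          ⟨D.mem_toSet_of_le hx' (hxx hq) hp.ge (by linarith) (by linarith),
            D.mem_left.2 hp.le⟩
        rw [hinter, hxt, Set.mem_singleton_iff, ← circlePos_inj (e := D.e), hp] at hmem
        change D.p = x.termPos D.e at hmem
        rw [newLeft_init] at hpos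
        linarith
      · refine key D.short D.short_mem (fun q hq => ?_)
          (circlePos_inj.1 (D.short_init.trans D.firstHalf_init.symm))
        rw [mem_firstHalf] at hq; rw [mem_short]; exact ⟨hq.1, by linarith⟩
      · exact absurd (hpos.trans D.secondHalf_init) hxp
      · exact key y (D.mem_rest.1 hy).1 subset_rfl rfl
  refine hsub.antisymm ?_
  rintro q rfl
  exact ⟨x.term_mem_toSet, hxy ▸ y.init_mem_toSet⟩

lemma isDiskFamily_newFamily (hI : IsDiskFamily r I) : IsDiskFamily r D.newFamily := by
  classical
  obtain ⟨h1, h2, h3, h4, h5, h6⟩ := D.order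
  have hterm : ∀ (x : Arc c) (q : AddCircle c), x.term = q ↔ x.termPos D.e = circlePos D.e q :=
    fun x q => circlePos_inj.symm
  have hinit : ∀ (x : Arc c) (q : AddCircle c), x.init = q ↔ x.initPos D.e = circlePos D.e q :=
    fun x q => circlePos_inj.symm
  have hold : ∀ q : AddCircle c, (∃ x ∈ I, q ∈ x.endpoints) → ∃ x ∈ D.newFamily,
      q ∈ x.endpoints := by
    rintro q ⟨x, hx, hq⟩
    by_cases hl : x = D.left
    · rw [hl, Arc.mem_endpoints_iff D.e, left_init, left_term] at hq
      rcases hq with hq | hq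
      · exact ⟨D.newLeft, D.mem_newFamily.2 (Or.inl rfl),
          (Arc.mem_endpoints_iff D.e _ q).2 (Or.inl (hq.trans D.newLeft_init.symm))⟩
      · exact ⟨D.firstHalf, D.mem_newFamily.2 (Or.inr (Or.inl rfl)),
          (Arc.mem_endpoints_iff D.e _ q).2 (Or.inr (hq.trans D.firstHalf_term.symm))⟩
    by_cases hs : x = D.short
    · rw [hs, Arc.mem_endpoints_iff D.e, short_init, short_term] at hq
      rcases hq with hq | hq
      · exact ⟨D.firstHalf, D.mem_newFamily.2 (Or.inr (Or.inl rfl)),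
          (Arc.mem_endpoints_iff D.e _ q).2 (Or.inl (hq.trans D.firstHalf_init.symm))⟩
      · exact ⟨D.secondHalf, D.mem_newFamily.2 (Or.inr (Or.inr (Or.inl rfl))),
          (Arc.mem_endpoints_iff D.e _ q).2 (Or.inr (hq.trans D.secondHalf_term.symm))⟩
    · exact ⟨x, D.mem_newFamily.2 (Or.inr (Or.inr (Or.inr (D.mem_rest.2 ⟨hx, hl, hs⟩)))), hq⟩
  have hnew : ∀ q : AddCircle c, circlePos D.e q ≠ D.p' →
      (∃ x ∈ D.newFamily, q ∈ x.endpoints) → ∃ x ∈ I, q ∈ x.endpoints := by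
    rintro q hqp ⟨x, hx, hq⟩
    have hl : circlePos D.e q = D.e ∨ circlePos D.e q = D.p → ∃ x ∈ I, q ∈ x.endpoints :=
      fun h => ⟨D.left, D.left_mem, by
        rwa [Arc.mem_endpoints_iff D.e, left_init, left_term]⟩
    have hs : circlePos D.e q = D.a ∨ circlePos D.e q = D.b → ∃ x ∈ I, q ∈ x.endpoints :=
      fun h => ⟨D.short, D.short_mem, by
        rwa [Arc.mem_endpoints_iff D.e, short_init, short_term]⟩
    rcases D.mem_newFamily.1 hx with rfl | rfl | rfl | hx
    · rw [Arc.mem_endpoints_iff D.e, newLeft_init, newLeft_term] at hq; tauto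
    · rw [Arc.mem_endpoints_iff D.e, firstHalf_init, firstHalf_term] at hq; tauto
    · rw [Arc.mem_endpoints_iff D.e, secondHalf_init, secondHalf_term] at hq; tauto
    · exact ⟨x, (D.mem_rest.1 hx).1, hq⟩
  refine ⟨hI.1, fun x hx y hy => D.union_ne_univ hI hx hy, fun q hq => ?_, fun q hq => ?_⟩
  · have hqI : ∀ x ∈ I, q ∉ x.endpoints := fun x hx hqx => by
      obtain ⟨y, hy, hqy⟩ := hold q ⟨x, hx, hqx⟩
      exact hq y hy hqy
    have hcard := hI.2.2.1 q hqI
    rw [card_mem_and_eq_sum, D.sum_eq] at hcard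
    rw [card_mem_and_eq_sum, D.sum_newFamily hI, ← hcard]
    have hA := hq _ (D.mem_newFamily.2 (Or.inl rfl))
    have hB := hqI _ D.left_mem
    rw [Arc.mem_endpoints_iff D.e, newLeft_init, newLeft_term] at hA
    rw [Arc.mem_endpoints_iff D.e, left_init, left_term] at hB
    simp only [mem_newLeft, mem_firstHalf, mem_secondHalf, mem_left, mem_short]
    grind
  · have hcount : Nat.card {x : Arc c // x ∈ D.newFamily ∧ x.term = q} = 1 ∧
        Nat.card {x : Arc c // x ∈ D.newFamily ∧ x.init = q} = 1 := by
      simp only [card_mem_and_eq_sum, D.sum_newFamily hI, hterm, hinit, newLeft_init,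
        newLeft_term, firstHalf_init, firstHalf_term, secondHalf_init, secondHalf_term]
      by_cases hqp : circlePos D.e q = D.p'
      · have hrest : ∀ x ∈ D.rest, x.termPos D.e ≠ D.p' ∧ x.initPos D.e ≠ D.p' := by
          intro x hx
          have hxI := (D.mem_rest.1 hx).1
          have ht := D.term_notMem x hxI
          have hi := D.init_notMem x hxI
          grind
        rw [hqp, Finset.sum_eq_zero fun x hx => if_neg (hrest x hx).1,
          Finset.sum_eq_zero fun x hx => if_neg (hrest x hx).2]
        grind
      · obtain ⟨h, h', -⟩ := hI.2.2.2 q (hnew q hqp hq)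
        simp only [card_mem_and_eq_sum, D.sum_eq, hterm, hinit, left_init, left_term,
          short_init, short_term] at h h'
        rw [if_neg (Ne.symm hqp), zero_add, zero_add]
        exact ⟨h, h'⟩
    refine ⟨hcount.1, hcount.2, fun x hx y hy hxq hyq => ?_⟩
    subst hxq
    exact D.inter_eq_singleton hI hx hy hyq.symm

lemma pairWeight_rest_le (hI : IsDiskFamily r I) {x : Arc c} (hx : x ∈ D.rest) :
    pairWeight D.newLeft x + pairWeight D.firstHalf x + pairWeight D.secondHalf x ≤
      pairWeight D.left x + pairWeight D.short x := by
  obtain ⟨h1, h2, h3, h4, h5, h6⟩ := D.order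
  obtain ⟨hxI, hxl, hxs⟩ := D.mem_rest.1 hx
  obtain ⟨hs1, hs2⟩ := D.init_ne_of_mem_rest hI hx
  obtain ⟨hu1, hu2⟩ := D.term_ne_of_mem_rest hI hx
  have hs3 := D.init_notMem x hxI
  have hu3 := D.term_notMem x hxI
  have hb := D.not_both x hxI hxs
  have hsu := x.initPos_ne_termPos D.e
  have hs : D.e ≤ x.initPos D.e := le_circlePos _ _
  have hu : D.e ≤ x.termPos D.e := le_circlePos _ _
  have hp : x.initPos D.e = D.p → D.p < x.termPos D.e := by
    intro h
    by_contra hlt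
    have hinter := hI.inter_eq D.left_mem hxI (circlePos_inj.1 (D.left_term.trans h.symm))
    have hmem : x.term ∈ D.left.toSet ∩ x.toSet :=
      ⟨D.mem_left.2 (not_lt.1 hlt), x.term_mem_toSet⟩
    rw [hinter] at hmem
    exact hu1 ((circlePos_inj.2 hmem).trans D.left_term)
  have hA : D.newLeft ≠ x := by
    rintro rfl; exact hs1 D.newLeft_init
  have hB : D.firstHalf ≠ x := by
    rintro rfl; exact hs2 D.firstHalf_init
  have hC : D.secondHalf ≠ x := by
    rintro rfl; exact hs3 (by rw [D.secondHalf_init]; exact ⟨h3, h4.le⟩)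
  rw [pairWeight_eq_positionWeight D.e (by rw [newLeft_init, newLeft_term]; linarith) hA,
    pairWeight_eq_positionWeight D.e (by rw [firstHalf_init, firstHalf_term]; linarith) hB,
    pairWeight_eq_positionWeight D.e (by rw [secondHalf_init, secondHalf_term]; linarith) hC,
    pairWeight_eq_positionWeight D.e (by rw [left_init, left_term]; linarith) hxl.symm,
    pairWeight_eq_positionWeight D.e (by rw [short_init, short_term]; linarith) hxs.symm,
    newLeft_init, newLeft_term, firstHalf_init, firstHalf_term, secondHalf_init,
    secondHalf_term, left_init, left_term, short_init, short_term]
  generalize x.initPos D.e = s at *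
  generalize x.termPos D.e = u at *
  exact positionWeight_split_le h2 h3 (h4.trans h5) (lt_of_le_of_ne hs (Ne.symm hs1)) hu hs2 hu1
    hu2 (fun h => hs3 ⟨h.1, h.2.trans h4.le⟩) (fun h => hu3 ⟨h.1, h.2.trans h4.le⟩) hb hp

lemma diskArea_newFamily_lt (hI : IsDiskFamily r I) : diskArea D.newFamily < diskArea I := by
  obtain ⟨h1, h2, h3, h4, h5, h6⟩ := D.order
  have hAB : pairWeight D.newLeft D.firstHalf = 0 := by
    rw [pairWeight_eq_positionWeight D.e (by rw [newLeft_init, newLeft_term]; linarith)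
      fun h => h1.ne (congrArg Arc.a h), newLeft_init, newLeft_term, firstHalf_init,
      firstHalf_term, positionWeight]
    simp only [xor_def]
    grind
  have hAC : pairWeight D.newLeft D.secondHalf = 1 / 4 := by
    rw [pairWeight_eq_positionWeight D.e (by rw [newLeft_init, newLeft_term]; linarith)
      fun h => (h1.trans (h2.trans h3)).ne (congrArg Arc.a h), newLeft_init, newLeft_term,
      secondHalf_init, secondHalf_term, positionWeight]
    simp
  have hBC : pairWeight D.firstHalf D.secondHalf = 0 := by
    rw [pairWeight_eq_positionWeight D.e (by rw [firstHalf_init, firstHalf_term]; linarith)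
      fun h => (h2.trans h3).ne (congrArg Arc.a h), firstHalf_init, firstHalf_term,
      secondHalf_init, secondHalf_term, positionWeight]
    simp only [xor_def]
    grind
  have hLS : pairWeight D.left D.short = 1 / 2 := by
    rw [pairWeight_eq_positionWeight D.e (by rw [left_init, left_term]; linarith)
      D.left_ne_short, left_init, left_term, short_init, short_term, positionWeight]
    simp only [xor_def]
    grind
  have hrest := Finset.sum_le_sum fun x (hx : x ∈ D.rest) => D.pairWeight_rest_le hI hx
  simp only [Finset.sum_add_distrib] at hrest
  simp only [diskArea_eq_sum, D.sum_eq, D.sum_newFamily hI, Finset.sum_add_distrib,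
    pairWeight_self, pairWeight_comm _ D.newLeft, pairWeight_comm D.secondHalf D.firstHalf,
    pairWeight_comm D.short D.left]
  have hcomm : ∀ y : Arc c, ∑ x ∈ D.rest, pairWeight x y = ∑ x ∈ D.rest, pairWeight y x :=
    fun y => Finset.sum_congr rfl fun x _ => pairWeight_comm x y
  simp only [hcomm]
  linarith [hcomm D.newLeft, pairWeight_comm D.newLeft D.firstHalf,
    pairWeight_comm D.newLeft D.secondHalf]

end SplitData

end Surgery

section MainResult

variable {r : ℕ} {c : ℝ} {I : Finset (Arc c)}

lemma exists_gap (S : Finset ℝ) {p b : ℝ} (hb : b ∈ S) (hpb : p < b) :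
    ∃ p'', p < p'' ∧ p'' < b ∧ ∀ x ∈ S, ¬ (p < x ∧ x ≤ p'') := by
  have hne : (S.filter fun x => p < x).Nonempty := ⟨b, Finset.mem_filter.2 ⟨hb, hpb⟩⟩
  have hm := Finset.mem_filter.1 (Finset.min'_mem _ hne)
  have hle : ∀ x ∈ S, p < x → (S.filter fun x => p < x).min' hne ≤ x :=
    fun x hx hpx => Finset.min'_le _ x (Finset.mem_filter.2 ⟨hx, hpx⟩)
  refine ⟨(p + (S.filter fun x => p < x).min' hne) / 2, by linarith [hm.2],
    by linarith [hm.2, hle b hb hpb], fun x hx h => ?_⟩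
  linarith [hm.2, hle x hx h.1]

/-- If the interior of an arc of minimal width contains an endpoint, the family can be split. -/
lemma exists_splitData [hc : Fact (0 < c)] (hI : IsDiskFamily r I) {α : Arc c} (hα : α ∈ I)
    (hmin : ∀ x ∈ I, α.width ≤ x.width) {q : AddCircle c} (hq : q ∈ α.interiorSet)
    (hqI : ∃ x ∈ I, q ∈ x.endpoints) : Nonempty (SplitData I) := by
  classical
  obtain ⟨hqα, hqi, hqt⟩ := Arc.mem_toSet_and_ne_of_mem_interiorSet hq
  obtain ⟨l, hl, rfl⟩ := hI.exists_term_eq hqI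
  have c0 := hc.out
  have hle : l.initPos l.a = l.a := circlePos_coe le_rfl (by linarith)
  set e := l.a
  have hlt : e < l.termPos e := lt_of_le_of_ne (le_circlePos _ _)
    fun h => l.initPos_ne_termPos e (hle.trans h)
  have hwl := Arc.width_eq_of_lt (hle.trans_lt hlt)
  have hwα := hmin l hl
  have hpi : l.termPos e ≠ α.initPos e := fun h => hqi (circlePos_inj.1 h)
  have hpt : l.termPos e ≠ α.termPos e := fun h => hqt (circlePos_inj.1 h)
  have hae : e ≤ α.initPos e := le_circlePos _ _
  have hac : α.initPos e < e + c := circlePos_lt _ _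
  have hbc : α.termPos e < e + c := circlePos_lt _ _
  have hαab : α.initPos e < l.termPos e ∧ l.termPos e < α.termPos e := by
    rw [Arc.mem_toSet_iff e] at hqα
    change CyclicMem _ _ (l.termPos e) at hqα
    rcases hqα with ⟨-, h1, h2⟩ | ⟨h, h1 | h1⟩
    · exact ⟨lt_of_le_of_ne h1 hpi.symm, lt_of_le_of_ne h2 hpt⟩
    · refine (hI.2.1 l hl α hα (Set.eq_univ_of_forall fun z => ?_)).elim
      have hz := le_circlePos e z
      rw [Set.mem_union, Arc.mem_toSet_iff e, Arc.mem_toSet_iff e, CyclicMem, CyclicMem, hle]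
      grind
    · have := Arc.width_eq_of_gt h
      linarith
  have hea : e < α.initPos e := by
    refine lt_of_le_of_ne hae fun h => ?_
    have := hI.eq_of_init_eq hl hα (circlePos_inj.1 (hle.trans h))
    exact hqt (by rw [this])
  obtain ⟨p'', hp1, hp2, hp3⟩ := exists_gap
    (I.image (Arc.initPos e) ∪ I.image (Arc.termPos e)) (b := α.termPos e)
    (Finset.mem_union_right _ (Finset.mem_image_of_mem _ hα)) hαab.2
  have hαlt := hαab.1.trans hαab.2
  refine ⟨⟨l, α, e, α.initPos e, l.termPos e, (l.termPos e + p'') / 2, p'', α.termPos e, hl, hα,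
    hea, hαab.1, by linarith, by linarith, hp2, hbc, hle, rfl, rfl, rfl,
    fun x hx => hp3 _ (Finset.mem_union_left _ (Finset.mem_image_of_mem _ hx)),
    fun x hx => hp3 _ (Finset.mem_union_right _ (Finset.mem_image_of_mem _ hx)), ?_⟩⟩
  intro x hx hne h1 h2 h3 h4
  rcases lt_or_gt_of_ne (x.initPos_ne_termPos e) with h | h
  · have hw := hmin x hx
    rw [Arc.width_eq_of_lt h, Arc.width_eq_of_lt hαlt] at hw
    exact hne (hI.eq_of_init_eq hx hα (circlePos_inj.1
      (show x.initPos e = α.initPos e by linarith)))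
  · refine hI.2.1 x hx α hα (Set.eq_univ_of_forall fun z => ?_)
    rw [Set.mem_union, Arc.mem_toSet_iff e, Arc.mem_toSet_iff e, CyclicMem, CyclicMem]
    grind

end MainResult

/-- **Lemma 8.5 of the paper**: an area-minimal `r`-disk family contains an arc whose
interior contains no endpoint of any arc of the family. -/
theorem exists_arc_no_endpoint_in_interior (r : ℕ) (hr : 0 < r) {c : ℝ}
    (I : Finset (Arc c)) (hI : IsAreaMinimal r I) :
    ∃ α ∈ I, ∀ β ∈ I, ∀ p ∈ α.interiorSet, p ∉ β.endpoints := by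
  obtain ⟨hD, hmin⟩ := hI
  have : Fact (0 < c) := ⟨hD.1⟩
  obtain ⟨α, hα, hw⟩ := I.exists_min_image Arc.width (hD.nonempty hr)
  refine ⟨α, hα, fun β hβ q hq hqβ => ?_⟩
  obtain ⟨D⟩ := exists_splitData hD hα hw hq ⟨β, hβ, hqβ⟩
  exact (hmin c D.newFamily (D.isDiskFamily_newFamily hD)).not_gt (D.diskArea_newFamily_lt hD)
end
end

section
/- Let 𝕀 be an area-minimal r-disk family consisting of n arcs. Then n ≥ 3r. -/
noncomputable section

/-- The point `x` lies in the cyclic closed interval from `s` to `t`. -/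
def CycIcc (s t x : ℝ) : Prop := (s < t ∧ s ≤ x ∧ x ≤ t) ∨ (t ≤ s ∧ (s ≤ x ∨ x ≤ t))

/-- The point `x` lies in the cyclic open interval from `s` to `t`. -/
def CycIoo (s t x : ℝ) : Prop := (s < t ∧ s < x ∧ x < t) ∨ (t ≤ s ∧ (s < x ∨ x < t))

/-- The cyclic intervals `[a, b]` and `[a', b']` have a common endpoint. -/
def CycShares (a b a' b' : ℝ) : Prop := a = a' ∨ a = b' ∨ b = a' ∨ b = b'

/-- The cyclic intervals `[a, b]` and `[a', b']` cross. -/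
def CycCrosses (a b a' b' : ℝ) : Prop :=
  ¬ CycShares a b a' b' ∧
    (Xor (CycIcc a b a') (CycIcc a b b') ∨ Xor (CycIcc a' b' a) (CycIcc a' b' b))

/-- Both endpoints of `[a', b']` lie in the interior of `[a, b]`. -/
def CycNested (a b a' b' : ℝ) : Prop := CycIoo a b a' ∧ CycIoo a b b'

/-- A disk family described by the coordinates in `[0, c)` of the initial endpoints `s i` and
the terminal endpoints `t i` of its arcs. -/
structure IsCoordFamily (r : ℕ) (c : ℝ) {ι : Type*} (s t : ι → ℝ) : Prop where
  s_mem : ∀ i, s i ∈ Set.Ico 0 c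
  t_mem : ∀ i, t i ∈ Set.Ico 0 c
  s_inj : Function.Injective s
  t_inj : Function.Injective t
  s_ne_t : ∀ i, s i ≠ t i
  exists_next : ∀ i, ∃ j, s j = t i
  not_cover : ∀ i j, ∃ x, ¬ CycIcc (s i) (t i) x ∧ ¬ CycIcc (s j) (t j) x
  adjacent : ∀ i j, t i = s j → ∀ x ∈ Set.Ico 0 c,
    CycIcc (s i) (t i) x → CycIcc (s j) (t j) x → x = t i
  card_eq : ∀ x ∈ Set.Ico 0 c, (∀ i, x ≠ s i ∧ x ≠ t i) →
    Nat.card {i // CycIcc (s i) (t i) x} = r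

section Cyclic

variable {a b a' b' : ℝ}

theorem CycNested.not_symm (hcov : ∃ x, ¬ CycIcc a b x ∧ ¬ CycIcc a' b' x)
    (h : CycNested a b a' b') : ¬ CycNested a' b' a b := by
  obtain ⟨x, hx⟩ := hcov
  simp only [CycNested, CycIoo, CycIcc] at *
  grind

theorem CycNested.not_shares (hcov : ∃ x, ¬ CycIcc a b x ∧ ¬ CycIcc a' b' x)
    (h : CycNested a b a' b') : ¬ CycShares a b a' b' := by
  obtain ⟨x, hx⟩ := hcov
  simp only [CycNested, CycIoo, CycIcc, CycShares] at *
  grind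

theorem CycNested.not_crosses (hcov : ∃ x, ¬ CycIcc a b x ∧ ¬ CycIcc a' b' x)
    (h : CycNested a b a' b') : ¬ CycCrosses a b a' b' := by
  obtain ⟨x, hx⟩ := hcov
  simp only [CycNested, CycIoo, CycIcc, CycShares, CycCrosses, Xor] at *
  grind

theorem CycNested.subset (hcov : ∃ x, ¬ CycIcc a b x ∧ ¬ CycIcc a' b' x)
    (h : CycNested a b a' b') {y : ℝ} (hy : CycIcc a' b' y) : CycIoo a b y := by
  obtain ⟨x, hx⟩ := hcov
  simp only [CycNested, CycIoo, CycIcc] at *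
  grind

theorem CycIoo.cycIcc {x : ℝ} (h : CycIoo a b x) : CycIcc a b x := by
  simp only [CycIoo, CycIcc] at *
  grind

theorem CycShares.symm (h : CycShares a b a' b') : CycShares a' b' a b := by
  simp only [CycShares] at *
  grind

theorem CycCrosses.symm (h : CycCrosses a b a' b') : CycCrosses a' b' a b :=
  ⟨fun hs => h.1 hs.symm, h.2.symm⟩

theorem CycCrosses.cycIoo_iff (hcov : ∃ x, ¬ CycIcc a b x ∧ ¬ CycIcc a' b' x)
    (h : CycCrosses a b a' b') : CycIoo a b a' ↔ ¬ CycIoo a' b' a := by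
  obtain ⟨x, hx⟩ := hcov
  simp only [CycIoo, CycIcc, CycShares, CycCrosses, Xor] at *
  grind

theorem cycIoo_iff_of_not_shares (hs : ¬ CycShares a b a' b') :
    CycIoo a b a' ↔ CycNested a b a' b' ∨ (CycCrosses a b a' b' ∧ CycIoo a b a') := by
  simp only [CycNested, CycIoo, CycIcc, CycShares, CycCrosses, Xor] at *
  grind

theorem not_cycIoo_of_cycIoo_terminal (hcov : ∃ x, ¬ CycIcc a b x ∧ ¬ CycIcc a' b' x)
    (h : CycIoo a b b') : ¬ CycIoo a' b' b := by
  obtain ⟨x, hx⟩ := hcov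
  simp only [CycIoo, CycIcc] at *
  grind

end Cyclic

theorem exists_gt_not_mem_Ioc {S : Set ℝ} (hS : S.Finite) {x c : ℝ} (hx : x < c) :
    ∃ y, x < y ∧ y < c ∧ ∀ z ∈ S, z ≤ x ∨ y < z := by
  have h : ∀ᶠ y in nhdsWithin x (Set.Ioi x), ∀ z ∈ S, z ≤ x ∨ y < z := by
    rw [Filter.eventually_all_finite hS]
    intro z _
    rcases le_or_gt z x with hz | hz
    · exact Filter.Eventually.of_forall fun _ => Or.inl hz
    · filter_upwards [Ioo_mem_nhdsGT hz] with y hy using Or.inr hy.2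
  obtain ⟨y, hy, hy'⟩ := (h.and (Ioo_mem_nhdsGT hx)).exists
  exact ⟨y, hy'.1, hy'.2, hy⟩

namespace IsCoordFamily

open Finset Classical

variable {r : ℕ} {c : ℝ} {ι : Type*} {s t : ι → ℝ}

theorem not_shares_of_cycIoo (h : IsCoordFamily r c s t) {i j : ι}
    (hij : CycIoo (s i) (t i) (s j)) : ¬ CycShares (s i) (t i) (s j) (t j) := by
  have h1 := h.s_ne_t i
  have h2 := h.s_ne_t j
  have h3 := h.adjacent j i
  have h4 := h.s_mem j
  have h5 : t i = t j → i = j := fun e => h.t_inj e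
  simp only [CycIoo, CycShares] at *
  intro hs
  rcases hs with hs | hs | hs | hs
  · grind
  · have := h3 hs.symm (s j) h4 (by simp only [CycIcc]; grind) (by simp only [CycIcc]; grind)
    grind
  · grind
  · obtain rfl := h5 hs
    grind

variable [Fintype ι]

/-- The number of ordered pairs of arcs that stand in the relation `R`. -/
def pairCount (s t : ι → ℝ) (R : ℝ → ℝ → ℝ → ℝ → Prop) : ℕ :=
  #{p : ι × ι | R (s p.1) (t p.1) (s p.2) (t p.2)}

theorem card_cycIoo_add_one (h : IsCoordFamily r c s t) (j : ι) :
    #{i | CycIoo (s i) (t i) (s j)} + 1 = r := by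
  obtain ⟨y, hy, hyc, hS⟩ := exists_gt_not_mem_Ioc
    ((Set.finite_range s).union (Set.finite_range t)) (h.s_mem j).2
  have hs : ∀ i, s i ≤ s j ∨ y < s i := fun i => hS _ (Or.inl ⟨i, rfl⟩)
  have ht : ∀ i, t i ≤ s j ∨ y < t i := fun i => hS _ (Or.inr ⟨i, rfl⟩)
  have hcard := h.card_eq y ⟨(h.s_mem j).1.trans hy.le, hyc⟩ fun i => by
    constructor
    · rcases hs i with h | h <;> grind
    · rcases ht i with h | h <;> grind
  rw [Nat.card_eq_fintype_card, Fintype.card_subtype] at hcard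
  rw [← hcard, ← card_insert_of_notMem (s := {i | CycIoo (s i) (t i) (s j)}) (a := j)]
  · congr 1
    ext i
    simp only [mem_insert, mem_filter, mem_univ, true_and]
    have h1 := hs i
    have h2 := ht i
    have h3 := h.s_ne_t i
    have h4 : s i = s j → i = j := fun e => h.s_inj e
    simp only [CycIoo, CycIcc]
    grind
  · have := h.s_ne_t j
    simp only [CycIoo]
    grind

theorem pairCount_cycIoo (h : IsCoordFamily r c s t) :
    pairCount s t (fun a b a' _ => CycIoo a b a') + Fintype.card ι = Fintype.card ι * r := by
  have : pairCount s t (fun a b a' _ => CycIoo a b a') =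
      ∑ j, #{i | CycIoo (s i) (t i) (s j)} := by
    simp only [pairCount, card_filter, Fintype.sum_prod_type]
    exact sum_comm
  rw [this, Fintype.card, card_eq_sum_ones, ← sum_add_distrib, sum_congr rfl
    fun j _ => h.card_cycIoo_add_one j]
  simp

theorem pairCount_swap (R : ℝ → ℝ → ℝ → ℝ → Prop) :
    pairCount s t (fun a b a' b' => R a' b' a b) = pairCount s t R := by
  unfold pairCount
  refine card_bij (fun p _ => p.swap) ?_ ?_ ?_
  · simp
  · rintro ⟨a, b⟩ _ ⟨a', b'⟩ _ e
    simpa [and_comm] using e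
  · rintro ⟨a, b⟩ hb
    exact ⟨(b, a), by simpa using hb, rfl⟩

theorem pairCount_nested_add (h : IsCoordFamily r c s t) :
    2 * pairCount s t CycNested + pairCount s t CycCrosses + 2 * Fintype.card ι =
      2 * (Fintype.card ι * r) := by
  have e1 : pairCount s t (fun a b a' _ => CycIoo a b a') = pairCount s t CycNested +
      pairCount s t (fun a b a' b' => CycCrosses a b a' b' ∧ CycIoo a b a') := by
    unfold pairCount
    rw [← card_union_of_disjoint]
    · congr 1
      ext ⟨i, j⟩
      simp only [mem_filter, mem_univ, true_and, mem_union]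
      constructor
      · exact fun hij => (cycIoo_iff_of_not_shares (h.not_shares_of_cycIoo hij)).1 hij
      · rintro (hij | hij)
        exacts [hij.1, hij.2]
    · rw [disjoint_left]
      simp only [mem_filter, mem_univ, true_and]
      exact fun p hp hc => hp.not_crosses (h.not_cover _ _) hc.1
  have e2 : pairCount s t CycCrosses =
      pairCount s t (fun a b a' b' => CycCrosses a b a' b' ∧ CycIoo a b a') +
      pairCount s t (fun a b a' b' => CycCrosses a' b' a b ∧ CycIoo a' b' a) := by
    unfold pairCount
    rw [← card_union_of_disjoint]
    · congr 1
      ext ⟨i, j⟩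
      simp only [mem_filter, mem_univ, true_and, mem_union]
      constructor
      · intro hij
        have := hij.cycIoo_iff (h.not_cover _ _)
        have := hij.symm
        grind
      · rintro (hij | hij)
        exacts [hij.1, hij.1.symm]
    · rw [disjoint_left]
      simp only [mem_filter, mem_univ, true_and]
      exact fun p hp hc => (hp.1.cycIoo_iff (h.not_cover _ _)).1 hp.2 hc.2
  have e3 := pairCount_swap (s := s) (t := t)
    (fun a b a' b' => CycCrosses a b a' b' ∧ CycIoo a b a')
  have e4 := h.pairCount_cycIoo
  omega

theorem pairCount_shares (h : IsCoordFamily r c s t) :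
    #{p : ι × ι | p.1 ≠ p.2 ∧ CycShares (s p.1) (t p.1) (s p.2) (t p.2)} =
      2 * Fintype.card ι := by
  have e1 : pairCount s t (fun _ b a' _ => b = a') = Fintype.card ι := by
    choose f hf using h.exists_next
    rw [Fintype.card, eq_comm]
    refine card_bij (fun i _ => (i, f i)) ?_ ?_ ?_
    · simp [hf]
    · intro i _ j _ e
      exact congrArg Prod.fst e
    · rintro ⟨i, j⟩ hij
      exact ⟨i, mem_univ _, by
        simp only [mem_filter, mem_univ, true_and] at hij
        rw [h.s_inj ((hf i).trans hij)]⟩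
  have e2 := pairCount_swap (s := s) (t := t) (fun _ b a' _ => b = a')
  have e3 : #{p : ι × ι | p.1 ≠ p.2 ∧ CycShares (s p.1) (t p.1) (s p.2) (t p.2)} =
      pairCount s t (fun _ b a' _ => b = a') + pairCount s t (fun a _ _ b' => b' = a) := by
    unfold pairCount
    rw [← card_union_of_disjoint]
    · congr 1
      ext ⟨i, j⟩
      simp only [mem_filter, mem_univ, true_and, mem_union, CycShares]
      have h1 := h.s_ne_t i
      have h3 : s i = s j → i = j := fun e => h.s_inj e
      have h4 : t i = t j → i = j := fun e => h.t_inj e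
      grind
    · rw [disjoint_filter]
      rintro ⟨i, j⟩ _ hp hq
      obtain ⟨x, hx⟩ := h.not_cover i j
      have h1 := h.s_ne_t i
      simp only [CycIcc] at *
      grind
  omega

theorem two_mul_pairCount_nested_le (h : IsCoordFamily r c s t) :
    2 * pairCount s t CycNested ≤ #{p : ι × ι | p.1 ≠ p.2 ∧
      ¬ CycShares (s p.1) (t p.1) (s p.2) (t p.2) ∧
      ¬ CycCrosses (s p.1) (t p.1) (s p.2) (t p.2) ∧
      ¬ CycNested (s p.1) (t p.1) (s p.2) (t p.2) ∧
      ¬ CycNested (s p.2) (t p.2) (s p.1) (t p.1)} := by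
  choose f hf using h.exists_next
  have hfinj : Function.Injective f := fun i j e => h.t_inj (by rw [← hf, ← hf, e])
  set A : Finset (ι × ι) := {p | CycNested (s p.1) (t p.1) (s p.2) (t p.2)} with hA
  have hdisj : ∀ i j, CycNested (s i) (t i) (s j) (t j) →
      f i ≠ j ∧ ¬ CycShares (s (f i)) (t (f i)) (s j) (t j) ∧
      ¬ CycCrosses (s (f i)) (t (f i)) (s j) (t j) ∧
      ¬ CycNested (s (f i)) (t (f i)) (s j) (t j) ∧
      ¬ CycNested (s j) (t j) (s (f i)) (t (f i)) := by
    intro i j hij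
    have hsub : ∀ y, CycIcc (s j) (t j) y → CycIoo (s i) (t i) y :=
      fun y hy => hij.subset (h.not_cover _ _) hy
    have hsep : ∀ y ∈ Set.Ico 0 c, CycIcc (s j) (t j) y → ¬ CycIcc (s (f i)) (t (f i)) y := by
      intro y hy hyj hyf
      have := h.adjacent i (f i) (hf i).symm y hy (hsub y hyj).cycIcc hyf
      have h1 := hsub y hyj
      have := h.s_ne_t i
      simp only [CycIoo] at h1
      grind
    have hs : ∀ k, CycIcc (s k) (t k) (s k) := fun k => by simp only [CycIcc]; grind
    have ht : ∀ k, CycIcc (s k) (t k) (t k) := fun k => by simp only [CycIcc]; grind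
    have n1 := hsep _ (h.s_mem j) (hs j)
    have n2 := hsep _ (h.t_mem j) (ht j)
    have n3 : ¬ CycIcc (s j) (t j) (s (f i)) := fun hh => hsep _ (h.s_mem (f i)) hh (hs _)
    have n4 : ¬ CycIcc (s j) (t j) (t (f i)) := fun hh => hsep _ (h.t_mem (f i)) hh (ht _)
    refine ⟨?_, ?_, ?_, fun hn => n1 hn.1.cycIcc, fun hn => n3 hn.1.cycIcc⟩
    · rintro e
      exact n1 (e ▸ hs (f i))
    · rintro (e | e | e | e)
      · exact n1 (e ▸ hs (f i))
      · exact n2 (e ▸ hs (f i))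
      · exact n1 (e ▸ ht (f i))
      · exact n2 (e ▸ ht (f i))
    · simp only [CycCrosses, Xor, n1, n2, n3, n4]
      simp
  have hc1 : #(A.image fun p => (f p.1, p.2)) = #A :=
    card_image_of_injective _ fun p q e => by
      simp only [Prod.mk.injEq] at e
      exact Prod.ext (hfinj e.1) e.2
  have hc2 : #(A.image fun p => (p.2, f p.1)) = #A :=
    card_image_of_injective _ fun p q e => by
      simp only [Prod.mk.injEq] at e
      exact Prod.ext (hfinj e.2) e.1
  have hd : Disjoint (A.image fun p => (f p.1, p.2)) (A.image fun p => (p.2, f p.1)) := by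
    rw [disjoint_left]
    intro q hq hq'
    simp only [mem_image, Prod.exists, hA, mem_filter, mem_univ, true_and] at hq hq'
    obtain ⟨i, j, hij, rfl⟩ := hq
    obtain ⟨i', j', hij', e⟩ := hq'
    simp only [Prod.mk.injEq] at e
    obtain ⟨rfl, rfl⟩ := e
    have h1 := hij.1
    have h2 := hij'.1
    rw [hf] at h1 h2
    exact not_cycIoo_of_cycIoo_terminal (h.not_cover i i') h1 h2
  have hA' : pairCount s t CycNested = #A := rfl
  rw [hA', two_mul]
  nth_rw 1 [← hc1]
  rw [← hc2, ← card_union_of_disjoint hd]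
  refine card_le_card (union_subset ?_ ?_)
  · intro q hq
    simp only [mem_image, Prod.exists, hA, mem_filter, mem_univ, true_and] at hq ⊢
    obtain ⟨i, j, hij, rfl⟩ := hq
    exact hdisj i j hij
  · intro q hq
    simp only [mem_image, Prod.exists, hA, mem_filter, mem_univ, true_and] at hq ⊢
    obtain ⟨i, j, hij, rfl⟩ := hq
    obtain ⟨g1, g2, g3, g4, g5⟩ := hdisj i j hij
    exact ⟨g1.symm, fun hh => g2 hh.symm, fun hh => g3 hh.symm, g5, g4⟩

theorem nested_bound (h : IsCoordFamily r c s t) :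
    2 * pairCount s t CycNested + 2 * (Fintype.card ι * r) + Fintype.card ι ≤
      Fintype.card ι * Fintype.card ι := by
  have e1 := h.two_mul_pairCount_nested_le
  have e2 := h.pairCount_nested_add
  have e3 := h.pairCount_shares
  have e4 := pairCount_swap (s := s) (t := t) CycNested
  have e5 : #{p : ι × ι | p.1 = p.2} = Fintype.card ι := by
    rw [Fintype.card, ← diag_card (univ : Finset ι)]
    congr 1
    ext p
    simp [mem_diag]
  have e6 : Fintype.card ι * Fintype.card ι = ∑ _p : ι × ι, 1 := by simp
  have e7 : ∑ _p : ι × ι, 1 = #{p : ι × ι | p.1 = p.2} +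
      #{p : ι × ι | p.1 ≠ p.2 ∧ CycShares (s p.1) (t p.1) (s p.2) (t p.2)} +
      pairCount s t CycCrosses + pairCount s t CycNested +
      pairCount s t (fun a b a' b' => CycNested a' b' a b) +
      #{p : ι × ι | p.1 ≠ p.2 ∧
      ¬ CycShares (s p.1) (t p.1) (s p.2) (t p.2) ∧
      ¬ CycCrosses (s p.1) (t p.1) (s p.2) (t p.2) ∧
      ¬ CycNested (s p.1) (t p.1) (s p.2) (t p.2) ∧
      ¬ CycNested (s p.2) (t p.2) (s p.1) (t p.1)} := by
    simp only [pairCount, card_filter, ← sum_add_distrib]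
    refine sum_congr rfl fun p _ => ?_
    obtain ⟨i, j⟩ := p
    have f0 : i = j → CycShares (s i) (t i) (s j) (t j) := by rintro rfl; exact Or.inl rfl
    have f1 : CycCrosses (s i) (t i) (s j) (t j) → ¬ CycShares (s i) (t i) (s j) (t j) :=
      fun hh => hh.1
    have f2 := CycNested.not_shares (h.not_cover i j)
    have f3 := CycNested.not_crosses (h.not_cover i j)
    have f4 := CycNested.not_symm (h.not_cover i j)
    have f5 : CycNested (s j) (t j) (s i) (t i) → ¬ CycShares (s i) (t i) (s j) (t j) :=
      fun hh hs => hh.not_shares (h.not_cover j i) hs.symm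
    have f6 : CycNested (s j) (t j) (s i) (t i) → ¬ CycCrosses (s i) (t i) (s j) (t j) :=
      fun hh hs => hh.not_crosses (h.not_cover j i) hs.symm
    simp only
    grind
  omega

end IsCoordFamily

theorem int_eq_zero_or_one_of_mul {z : ℤ} {c : ℝ} (hc : 0 < c) (h1 : -c < z * c)
    (h2 : z * c < 2 * c) : z = 0 ∨ z = 1 := by
  have h3 : (-1 : ℝ) < z := by
    by_contra hh
    nlinarith
  have h4 : (z : ℝ) < 2 := lt_of_mul_lt_mul_right h2 hc.le
  have h5 : -1 < z := by exact_mod_cast h3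
  have h6 : z < 2 := by exact_mod_cast h4
  omega

open Finset Classical in
theorem natCard_pairs {c : ℝ} (I : Finset (Arc c)) (R : Arc c → Arc c → Prop) :
    Nat.card {p : Arc c × Arc c // p.1 ∈ I ∧ p.2 ∈ I ∧ R p.1 p.2} =
      #{p : I × I | R p.1 p.2} := by
  rw [← Fintype.card_subtype, ← Nat.card_eq_fintype_card]
  exact Nat.card_congr ⟨fun p => ⟨(⟨p.1.1, p.2.1⟩, ⟨p.1.2, p.2.2.1⟩), p.2.2.2⟩,
    fun p => ⟨(p.1.1.1, p.1.2.1), p.1.1.2, p.1.2.2, p.2⟩, fun _ => rfl, fun _ => rfl⟩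

theorem IsDiskFamily.card_pos {r : ℕ} {c : ℝ} (hr : 0 < r) {I : Finset (Arc c)}
    (h : IsDiskFamily r I) : 0 < I.card := by
  rw [Finset.card_pos, Finset.nonempty_iff_ne_empty]
  rintro rfl
  have := h.2.2.1 0 (by simp)
  simp at this
  omega

section Coordinates

variable {c : ℝ}

/-- The representative in `[0, c)` of a point of the circle `ℝ/cℤ`. -/
def circleCoord [Fact (0 < c)] (p : AddCircle c) : ℝ := AddCircle.equivIco c 0 p

variable [hc : Fact (0 < c)]

theorem circleCoord_mem (p : AddCircle c) : circleCoord p ∈ Set.Ico 0 c := by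
  simpa [circleCoord] using (AddCircle.equivIco c 0 p).2

theorem coe_circleCoord (p : AddCircle c) : (circleCoord p : AddCircle c) = p :=
  (AddCircle.equivIco c 0).symm_apply_apply p

theorem circleCoord_injective : Function.Injective (circleCoord : AddCircle c → ℝ) :=
  fun p q e => by rw [← coe_circleCoord p, e, coe_circleCoord]

theorem circleCoord_inj {p q : AddCircle c} : circleCoord p = circleCoord q ↔ p = q :=
  circleCoord_injective.eq_iff

theorem circleCoord_coe_eq {x y : ℝ} (hy : y ∈ Set.Ico 0 c) (m : ℤ) (hxy : x = y + m * c) :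
    circleCoord (x : AddCircle c) = y := by
  have h1 := circleCoord_mem (x : AddCircle c)
  have h2 := coe_circleCoord (x : AddCircle c)
  have h3 : (x : AddCircle c) = y := by
    rw [← sub_eq_zero, ← AddCircle.coe_sub, AddCircle.coe_eq_zero_iff]
    exact ⟨m, by rw [hxy]; simp⟩
  rw [h3] at h2
  have := (AddCircle.coe_eq_coe_iff_of_mem_Ico (p := c) (a := 0)
    (by simpa [h3] using h1) (by simpa using hy)).1 h2
  rw [h3, this]

theorem circleCoord_coe {x : ℝ} (hx : x ∈ Set.Ico 0 c) : circleCoord (x : AddCircle c) = x :=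
  circleCoord_coe_eq hx 0 (by simp)

theorem exists_eq_circleCoord_add (x : ℝ) :
    ∃ m : ℤ, x = circleCoord (x : AddCircle c) + m * c := by
  have h := coe_circleCoord (x : AddCircle c)
  rw [eq_comm, ← sub_eq_zero, ← AddCircle.coe_sub, AddCircle.coe_eq_zero_iff] at h
  obtain ⟨m, hm⟩ := h
  refine ⟨m, ?_⟩
  rw [zsmul_eq_mul] at hm
  linarith

namespace Arc

theorem circleCoord_endpoints (α : Arc c) : ∃ m : ℤ, α.a = circleCoord α.init + m * c ∧
    ((circleCoord α.init < circleCoord α.term ∧ α.b = circleCoord α.term + m * c) ∨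
      (circleCoord α.term < circleCoord α.init ∧ α.b = circleCoord α.term + m * c + c)) := by
  obtain ⟨k, hk⟩ := exists_eq_circleCoord_add (c := c) α.a
  obtain ⟨l, hl⟩ := exists_eq_circleCoord_add (c := c) α.b
  change α.a = circleCoord α.init + k * c at hk
  change α.b = circleCoord α.term + l * c at hl
  have h1 := circleCoord_mem α.init
  have h2 := circleCoord_mem α.term
  have h3 := α.width_pos
  have h4 := α.width_lt
  have hc0 := hc.out
  simp only [Set.mem_Ico] at h1 h2
  refine ⟨k, hk, ?_⟩
  have hz : ((l - k : ℤ) : ℝ) * c = l * c - k * c := by push_cast; ring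
  rcases int_eq_zero_or_one_of_mul (z := l - k) hc0 (by linarith) (by linarith) with h | h
  · have : l = k := by omega
    subst this
    left
    exact ⟨by linarith, hl⟩
  · rw [h] at hz
    push_cast at hz
    right
    exact ⟨by linarith, by linarith⟩

theorem mem_toSet_iff_s10 (α : Arc c) (p : AddCircle c) : p ∈ α.toSet ↔
    CycIcc (circleCoord α.init) (circleCoord α.term) (circleCoord p) := by
  obtain ⟨k, hk, hb⟩ := α.circleCoord_endpoints
  have h1 := circleCoord_mem α.init
  have h2 := circleCoord_mem α.term
  have h3 := circleCoord_mem p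
  have hc0 := hc.out
  simp only [Set.mem_Ico] at h1 h2 h3
  simp only [toSet, Set.mem_image, Set.mem_Icc]
  constructor
  · rintro ⟨y, ⟨hy1, hy2⟩, rfl⟩
    obtain ⟨m, hm⟩ := exists_eq_circleCoord_add (c := c) y
    have hz : ((m - k : ℤ) : ℝ) * c = m * c - k * c := by push_cast; ring
    rcases int_eq_zero_or_one_of_mul (z := m - k) hc0 (by grind) (by grind) with h | h
    all_goals
      rw [h] at hz
      push_cast at hz
      simp only [CycIcc]
      grind
  · intro h
    have hcoe : ∀ m : ℤ, ((circleCoord p + m * c : ℝ) : AddCircle c) = p := fun m => by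
      refine circleCoord_injective ?_
      exact circleCoord_coe_eq (circleCoord_mem p) m rfl
    by_cases hx : circleCoord α.init ≤ circleCoord p
    · refine ⟨_, ?_, hcoe k⟩
      simp only [CycIcc] at h
      grind
    · refine ⟨_, ?_, hcoe (k + 1)⟩
      push_cast
      simp only [CycIcc] at h
      grind

theorem circleCoord_init_ne_term (α : Arc c) : circleCoord α.init ≠ circleCoord α.term := by
  obtain ⟨m, -, h | h⟩ := α.circleCoord_endpoints
  exacts [h.1.ne, h.1.ne']

theorem sharesEndpoint_iff_s10 (α β : Arc c) : α.SharesEndpoint β ↔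
    CycShares (circleCoord α.init) (circleCoord α.term) (circleCoord β.init)
      (circleCoord β.term) := by
  simp only [SharesEndpoint, endpoints, CycShares, Set.Nonempty, Set.mem_inter_iff,
    Set.mem_insert_iff, Set.mem_singleton_iff, circleCoord_inj]
  constructor
  · rintro ⟨x, rfl | rfl, h | h⟩ <;> simp [h]
  · rintro (h | h | h | h)
    exacts [⟨_, Or.inl rfl, Or.inl h⟩, ⟨_, Or.inl rfl, Or.inr h⟩, ⟨_, Or.inr rfl, Or.inl h⟩,
      ⟨_, Or.inr rfl, Or.inr h⟩]

theorem crosses_iff_s10 (α β : Arc c) : α.Crosses β ↔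
    CycCrosses (circleCoord α.init) (circleCoord α.term) (circleCoord β.init)
      (circleCoord β.term) := by
  simp only [Crosses, CycCrosses, sharesEndpoint_iff_s10, mem_toSet_iff_s10]
  rfl

end Arc

theorem IsDiskFamily.isCoordFamily {r : ℕ} {I : Finset (Arc c)} (h : IsDiskFamily r I) :
    IsCoordFamily r c (fun i : I => circleCoord i.1.init) (fun i : I => circleCoord i.1.term) where
  s_mem i := circleCoord_mem _
  t_mem i := circleCoord_mem _
  s_inj i j e := by
    have h1 := (h.2.2.2 i.1.init ⟨i.1, i.2, Or.inl rfl⟩).2.1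
    rw [Nat.card_eq_one_iff_unique] at h1
    have h2 := h1.1.elim ⟨i.1, i.2, rfl⟩ ⟨j.1, j.2, (circleCoord_injective e).symm⟩
    exact Subtype.ext (Subtype.mk.inj h2)
  t_inj i j e := by
    have h1 := (h.2.2.2 i.1.term ⟨i.1, i.2, Or.inr rfl⟩).1
    rw [Nat.card_eq_one_iff_unique] at h1
    have h2 := h1.1.elim ⟨i.1, i.2, rfl⟩ ⟨j.1, j.2, (circleCoord_injective e).symm⟩
    exact Subtype.ext (Subtype.mk.inj h2)
  s_ne_t i := i.1.circleCoord_init_ne_term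
  exists_next i := by
    have h1 := (h.2.2.2 i.1.term ⟨i.1, i.2, Or.inr rfl⟩).2.1
    rw [Nat.card_eq_one_iff_unique] at h1
    obtain ⟨⟨β, hβ, e⟩⟩ := h1.2
    exact ⟨⟨β, hβ⟩, congrArg _ e⟩
  not_cover i j := by
    have h1 := h.2.1 i.1 i.2 j.1 j.2
    rw [Set.ne_univ_iff_exists_notMem] at h1
    obtain ⟨p, hp⟩ := h1
    refine ⟨circleCoord p, ?_⟩
    rwa [Set.mem_union, not_or, Arc.mem_toSet_iff_s10, Arc.mem_toSet_iff_s10] at hp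
  adjacent i j e x hx h1 h2 := by
    have h3 := (h.2.2.2 i.1.term ⟨i.1, i.2, Or.inr rfl⟩).2.2 i.1 i.2 j.1 j.2 rfl
      (circleCoord_injective e).symm
    have h4 : (x : AddCircle c) ∈ i.1.toSet ∩ j.1.toSet := by
      rw [Set.mem_inter_iff, Arc.mem_toSet_iff_s10, Arc.mem_toSet_iff_s10, circleCoord_coe hx]
      exact ⟨h1, h2⟩
    rw [h3, Set.mem_singleton_iff] at h4
    rw [← h4, circleCoord_coe hx]
  card_eq x hx hne := by
    rw [← h.2.2.1 (x : AddCircle c)]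
    · refine Nat.card_congr ⟨fun i => ⟨i.1.1, i.1.2, ?_⟩, fun i => ⟨⟨i.1, i.2.1⟩, ?_⟩,
        fun _ => rfl, fun _ => rfl⟩
      · rw [Arc.mem_toSet_iff_s10, circleCoord_coe hx]
        exact i.2
      · have := i.2.2
        rwa [Arc.mem_toSet_iff_s10, circleCoord_coe hx] at this
    · rintro α hα (e | e)
      · exact (hne ⟨α, hα⟩).1 (by rw [← e, circleCoord_coe hx])
      · exact (hne ⟨α, hα⟩).2 (by
          rw [Set.mem_singleton_iff] at e
          rw [← e, circleCoord_coe hx])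

/-- The number of ordered pairs of arcs of `I` such that the second is nested in the first. -/
def nestedCount (I : Finset (Arc c)) : ℕ :=
  IsCoordFamily.pairCount (fun i : I => circleCoord i.1.init) (fun i : I => circleCoord i.1.term)
    CycNested

theorem IsDiskFamily.diskArea_eq {r : ℕ} {I : Finset (Arc c)} (h : IsDiskFamily r I) :
    diskArea I = I.card * r - I.card / 2 - nestedCount I := by
  have h1 := h.isCoordFamily.pairCount_nested_add
  have h2 := h.isCoordFamily.pairCount_shares
  rw [Fintype.card_coe] at h1 h2
  have h5 : (2 * nestedCount I : ℝ) + (IsCoordFamily.pairCount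
      (fun i : I => circleCoord i.1.init) (fun i : I => circleCoord i.1.term) CycCrosses : ℕ) +
      2 * I.card = 2 * (I.card * r) := by exact_mod_cast h1
  have e3 : Nat.card {p : Arc c × Arc c // p.1 ∈ I ∧ p.2 ∈ I ∧ p.1.Crosses p.2} =
      IsCoordFamily.pairCount
      (fun i : I => circleCoord i.1.init) (fun i : I => circleCoord i.1.term) CycCrosses := by
    rw [natCard_pairs I Arc.Crosses, IsCoordFamily.pairCount]
    congr 1
    ext p
    simp only [Finset.mem_filter, Finset.mem_univ, true_and, Arc.crosses_iff_s10]
  have e4 : Nat.card {p : Arc c × Arc c //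
      p.1 ∈ I ∧ p.2 ∈ I ∧ p.1 ≠ p.2 ∧ p.1.SharesEndpoint p.2} = 2 * I.card := by
    rw [natCard_pairs I fun α β => α ≠ β ∧ α.SharesEndpoint β, ← h2]
    congr 1
    ext p
    simp only [Finset.mem_filter, Finset.mem_univ, true_and, ne_eq, Arc.sharesEndpoint_iff_s10,
      Subtype.coe_inj]
  rw [diskArea, e3, e4]
  push_cast
  linarith

theorem IsDiskFamily.nestedCount_le {r : ℕ} {I : Finset (Arc c)} (h : IsDiskFamily r I) :
    2 * nestedCount I + 2 * (I.card * r) + I.card ≤ I.card * I.card := by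
  simpa [nestedCount] using h.isCoordFamily.nested_bound

end Coordinates

namespace TriangularDisk

variable {r : ℕ}

/-- The `j`-th of the `r` concentric arcs of the `k`-th of three bundles on the circle of
circumference `3r`. -/
def arc (p : Fin 3 × Fin r) : Arc (3 * r : ℝ) where
  a := p.1 * r + p.2
  b := (p.1 + 2) * r - 1 - p.2
  width_pos := by
    have : (p.2 : ℝ) + 1 ≤ r := by exact_mod_cast p.2.2
    linarith
  width_lt := by
    have : (p.2 : ℝ) + 1 ≤ r := by exact_mod_cast p.2.2
    have : (0 : ℝ) ≤ p.2 := by positivity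
    linarith

/-- The coordinate of the initial endpoint of `arc (k, j)`. -/
def start (p : Fin 3 × Fin r) : ℝ := p.1 * r + p.2

/-- The coordinate of the terminal endpoint of `arc (k, j)`. -/
def finish (p : Fin 3 × Fin r) : ℝ :=
  (p.1 + 2) * r - 1 - p.2 - (if p.1 = 2 then 3 * r else 0 : ℝ)

theorem start_zero (j : Fin r) : start (0, j) = j := by simp [start]

theorem start_one (j : Fin r) : start (1, j) = r + j := by simp [start]

theorem start_two (j : Fin r) : start (2, j) = 2 * r + j := by simp [start]

theorem finish_zero (j : Fin r) : finish (0, j) = 2 * r - 1 - j := by simp [finish]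

theorem finish_one (j : Fin r) : finish (1, j) = 3 * r - 1 - j := by
  rw [finish, if_neg (by simp), Fin.val_one, Nat.cast_one]
  ring

theorem finish_two (j : Fin r) : finish (2, j) = r - 1 - j := by
  rw [finish, if_pos rfl, Fin.val_two, Nat.cast_two]
  ring

theorem cast_nonneg_and_lt (j : Fin r) : (0 : ℝ) ≤ j ∧ (j : ℝ) + 1 ≤ r :=
  ⟨by positivity, by exact_mod_cast j.2⟩

theorem cast_rev (j : Fin r) : ((j.rev : ℕ) : ℝ) = r - 1 - j := by
  rw [Fin.val_rev, Nat.cast_sub (by omega)]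
  push_cast
  ring

theorem start_mem (p : Fin 3 × Fin r) : start p ∈ Set.Ico (0 : ℝ) (3 * r) := by
  obtain ⟨k, j⟩ := p
  have := cast_nonneg_and_lt j
  rw [Set.mem_Ico]
  fin_cases k <;> simp [start_zero, start_one, start_two] <;> grind

theorem finish_mem (p : Fin 3 × Fin r) : finish p ∈ Set.Ico (0 : ℝ) (3 * r) := by
  obtain ⟨k, j⟩ := p
  have := cast_nonneg_and_lt j
  rw [Set.mem_Ico]
  fin_cases k <;> simp [finish_zero, finish_one, finish_two] <;> grind

theorem start_injective : Function.Injective (start (r := r)) := by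
  rintro ⟨k, j⟩ ⟨k', j'⟩ e
  have h1 := cast_nonneg_and_lt j
  have h2 := cast_nonneg_and_lt j'
  fin_cases k <;> fin_cases k' <;> simp [start_zero, start_one, start_two] at e ⊢
  all_goals first | (exact Fin.ext e) | (exfalso; linarith)

/-- The index of the arc that starts where the given arc ends. -/
def next (p : Fin 3 × Fin r) : Fin 3 × Fin r := (p.1 + 1, p.2.rev)

/-- The index of the arc that ends where the given arc starts. -/
def prev (p : Fin 3 × Fin r) : Fin 3 × Fin r := (p.1 - 1, p.2.rev)

theorem next_prev (p : Fin 3 × Fin r) : next (prev p) = p := by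
  simp [next, prev]

theorem prev_next (p : Fin 3 × Fin r) : prev (next p) = p := by
  simp [next, prev]

theorem start_next (p : Fin 3 × Fin r) : start (next p) = finish p := by
  obtain ⟨k, j⟩ := p
  fin_cases k <;> simp [next, start, finish] <;> ring

theorem finish_injective : Function.Injective (finish (r := r)) := by
  intro p q e
  rw [← start_next, ← start_next] at e
  rw [← prev_next p, start_injective e, prev_next]

theorem not_cover (p q : Fin 3 × Fin r) : ∃ x ∈ Set.Ico (0 : ℝ) (3 * r),
    ¬ CycIcc (start p) (finish p) x ∧ ¬ CycIcc (start q) (finish q) x := by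
  obtain ⟨k, j⟩ := p
  obtain ⟨k', j'⟩ := q
  have h1 := cast_nonneg_and_lt j
  have h2 := cast_nonneg_and_lt j'
  by_cases h01 : k ≠ 2 ∧ k' ≠ 2
  · refine ⟨3 * r - 1 / 2, ⟨by linarith, by linarith⟩, ?_⟩
    fin_cases k <;> fin_cases k' <;>
      simp [start_zero, start_one, finish_zero, finish_one, CycIcc] at h01 ⊢ <;> grind
  by_cases h12 : k ≠ 0 ∧ k' ≠ 0
  · refine ⟨r - 1 / 2, ⟨by linarith, by linarith⟩, ?_⟩
    fin_cases k <;> fin_cases k' <;>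
      simp [start_two, start_one, finish_two, finish_one, CycIcc] at h12 ⊢ <;> grind
  · refine ⟨2 * r - 1 / 2, ⟨by linarith, by linarith⟩, ?_⟩
    fin_cases k <;> fin_cases k' <;>
      simp [start_zero, start_two, finish_zero, finish_two, CycIcc] at h01 h12 ⊢ <;> grind

theorem eq_finish_of_mem_next (p : Fin 3 × Fin r) {x : ℝ} (hx : x ∈ Set.Ico (0 : ℝ) (3 * r))
    (h1 : CycIcc (start p) (finish p) x) (h2 : CycIcc (start (next p)) (finish (next p)) x) :
    x = finish p := by
  obtain ⟨k, j⟩ := p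
  have h3 := cast_nonneg_and_lt j
  obtain ⟨h4, h5⟩ := hx
  fin_cases k <;>
    simp [next, start, finish, CycIcc] at h1 h2 ⊢ <;> grind

open Finset Classical in
theorem card_cycIcc {x : ℝ} (hx : x ∈ Set.Ico (0 : ℝ) (3 * r))
    (hne : ∀ p : Fin 3 × Fin r, x ≠ start p) :
    #{p : Fin 3 × Fin r | CycIcc (start p) (finish p) x} = r := by
  rw [card_filter, Fintype.sum_prod_type, Fin.sum_univ_three]
  have hr : ∑ _j : Fin r, 1 = r := by simp
  obtain ⟨h4, h5⟩ := hx
  by_cases hx1 : x < r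
  · rw [← Equiv.sum_comp Fin.revPerm (fun j => if CycIcc (start (2, j)) _ x then 1 else 0),
      ← sum_add_distrib, ← sum_add_distrib]
    refine Eq.trans (sum_congr rfl fun j _ => ?_) hr
    have h3 := cast_nonneg_and_lt j
    have h6 := hne (0, j)
    simp only [Fin.revPerm_apply, start_zero, start_one, start_two, finish_zero, finish_one,
      finish_two, cast_rev, CycIcc] at h6 ⊢
    grind
  by_cases hx2 : x < 2 * r
  · rw [← Equiv.sum_comp Fin.revPerm (fun j => if CycIcc (start (0, j)) _ x then 1 else 0),
      ← sum_add_distrib, ← sum_add_distrib]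
    refine Eq.trans (sum_congr rfl fun j _ => ?_) hr
    have h3 := cast_nonneg_and_lt j
    have h6 := hne (1, j)
    simp only [Fin.revPerm_apply, start_zero, start_one, start_two, finish_zero, finish_one,
      finish_two, cast_rev, CycIcc] at h6 ⊢
    grind
  · rw [← Equiv.sum_comp Fin.revPerm (fun j => if CycIcc (start (1, j)) _ x then 1 else 0),
      ← sum_add_distrib, ← sum_add_distrib]
    refine Eq.trans (sum_congr rfl fun j _ => ?_) hr
    have h3 := cast_nonneg_and_lt j
    have h6 := hne (2, j)
    simp only [Fin.revPerm_apply, start_zero, start_one, start_two, finish_zero, finish_one,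
      finish_two, cast_rev, CycIcc] at h6 ⊢
    grind

theorem nested (k : Fin 3) {i j : Fin r} (hij : i < j) :
    CycNested (start (k, i)) (finish (k, i)) (start (k, j)) (finish (k, j)) := by
  have h1 := cast_nonneg_and_lt i
  have h2 := cast_nonneg_and_lt j
  have h3 : (i : ℝ) < j := by exact_mod_cast hij
  fin_cases k <;>
    simp [start_zero, start_one, start_two, finish_zero, finish_one, finish_two, CycNested,
      CycIoo] <;> grind

open Finset in
theorem two_mul_card_lt (r : ℕ) : 2 * #{q : Fin r × Fin r | q.1 < q.2} + r = r * r := by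
  have h1 : #{q : Fin r × Fin r | q.2 < q.1} = #{q : Fin r × Fin r | q.1 < q.2} :=
    card_bij (fun q _ => q.swap) (by simp) (by simp +contextual [Prod.ext_iff])
      fun q hq => ⟨q.swap, by simpa using hq, by simp⟩
  have h2 : #{q : Fin r × Fin r | q.1 = q.2} = r := by
    have : ({q : Fin r × Fin r | q.1 = q.2} : Finset _) = (univ : Finset (Fin r)).diag := by
      ext q
      simp [mem_diag]
    rw [this, diag_card, card_univ, Fintype.card_fin]
  have h3 : ∑ _q : Fin r × Fin r, 1 = #{q : Fin r × Fin r | q.1 < q.2} +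
      #{q : Fin r × Fin r | q.2 < q.1} + #{q : Fin r × Fin r | q.1 = q.2} := by
    simp only [card_filter, ← sum_add_distrib]
    refine sum_congr rfl fun q _ => ?_
    rcases lt_trichotomy q.1 q.2 with h | h | h
    · simp [h, h.not_gt, h.ne]
    · simp [h]
    · simp [h, h.not_gt, h.ne']
  simp at h3
  omega

section

variable [Fact ((0 : ℝ) < 3 * r)]

theorem circleCoord_init (p : Fin 3 × Fin r) : circleCoord (arc p).init = start p :=
  circleCoord_coe (start_mem p)

theorem circleCoord_term (p : Fin 3 × Fin r) : circleCoord (arc p).term = finish p := by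
  refine circleCoord_coe_eq (finish_mem p) (if p.1 = 2 then 1 else 0) ?_
  simp only [arc, finish]
  split_ifs <;> push_cast <;> ring

theorem arc_injective : Function.Injective (arc (r := r)) := fun p q e =>
  start_injective (by rw [← circleCoord_init, e, circleCoord_init])

end

/-- The family of all `3r` arcs. -/
def family (r : ℕ) : Finset (Arc (3 * r : ℝ)) :=
  (Set.finite_range (arc (r := r))).toFinset

theorem mem_family {α : Arc (3 * r : ℝ)} : α ∈ family r ↔ ∃ p, arc p = α := by
  simp [family]

section

variable [hr : Fact ((0 : ℝ) < 3 * r)]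

/-- The arcs of the family are indexed by `Fin 3 × Fin r`. -/
def familyEquiv : Fin 3 × Fin r ≃ family r :=
  Equiv.ofBijective (fun p => ⟨arc p, mem_family.2 ⟨p, rfl⟩⟩)
    ⟨fun _ _ e => arc_injective (Subtype.mk.inj e),
      fun ⟨_, h⟩ => (mem_family.1 h).imp fun _ e => Subtype.ext e⟩

theorem card_family : (family r).card = 3 * r := by
  rw [← Fintype.card_coe, ← Fintype.card_congr familyEquiv]
  simp

theorem natCard_family (P : Arc (3 * r : ℝ) → Prop) :
    Nat.card {α // α ∈ family r ∧ P α} = Nat.card {p : Fin 3 × Fin r // P (arc p)} := by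
  symm
  refine Nat.card_congr (Equiv.ofBijective
    (fun p => ⟨arc p.1, mem_family.2 ⟨p.1, rfl⟩, p.2⟩) ⟨fun p q e => ?_, ?_⟩)
  · exact Subtype.ext (arc_injective (Subtype.mk.inj e))
  · rintro ⟨α, hα, hP⟩
    obtain ⟨p, rfl⟩ := mem_family.1 hα
    exact ⟨⟨p, hP⟩, rfl⟩

theorem isDiskFamily : IsDiskFamily r (family r) := by
  refine ⟨hr.out, ?_, ?_, ?_⟩
  · intro α hα β hβ
    obtain ⟨p, rfl⟩ := mem_family.1 hα
    obtain ⟨q, rfl⟩ := mem_family.1 hβ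
    obtain ⟨x, hx, h1, h2⟩ := not_cover p q
    rw [Set.ne_univ_iff_exists_notMem]
    refine ⟨(x : AddCircle (3 * r : ℝ)), ?_⟩
    rw [Set.mem_union, Arc.mem_toSet_iff_s10, Arc.mem_toSet_iff_s10, circleCoord_coe hx,
      circleCoord_init, circleCoord_term, circleCoord_init, circleCoord_term]
    tauto
  · intro x hx
    classical
    rw [natCard_family, Nat.card_eq_fintype_card, Fintype.card_subtype]
    simp only [Arc.mem_toSet_iff_s10, circleCoord_init, circleCoord_term]
    convert card_cycIcc (circleCoord_mem x) fun p e => ?_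
    refine hx (arc p) (mem_family.2 ⟨p, rfl⟩) (Or.inl ?_)
    rwa [← circleCoord_inj, circleCoord_init]
  · rintro x ⟨α, hα, hx⟩
    obtain ⟨p, hp⟩ : ∃ p : Fin 3 × Fin r, finish p = circleCoord x := by
      obtain ⟨p, rfl⟩ := mem_family.1 hα
      rcases hx with rfl | hx
      · exact ⟨prev p, by rw [← start_next, next_prev, circleCoord_init]⟩
      · rw [Set.mem_singleton_iff] at hx
        exact ⟨p, by rw [hx, circleCoord_term]⟩
    have hterm : ∀ q : Fin 3 × Fin r, (arc q).term = x ↔ q = p := fun q => by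
      rw [← circleCoord_inj, circleCoord_term, ← hp, finish_injective.eq_iff]
    have hinit : ∀ q : Fin 3 × Fin r, (arc q).init = x ↔ q = next p := fun q => by
      rw [← circleCoord_inj, circleCoord_init, ← hp, ← start_next, start_injective.eq_iff]
    refine ⟨?_, ?_, ?_⟩
    · simp [natCard_family, hterm]
    · simp [natCard_family, hinit]
    · intro α hα β hβ h1 h2
      obtain ⟨q, rfl⟩ := mem_family.1 hα
      obtain ⟨q', rfl⟩ := mem_family.1 hβ
      obtain rfl := (hterm q).1 h1
      obtain rfl := (hinit q').1 h2
      ext y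
      rw [Set.mem_inter_iff, Arc.mem_toSet_iff_s10, Arc.mem_toSet_iff_s10, Set.mem_singleton_iff,
        circleCoord_init, circleCoord_term, circleCoord_init, circleCoord_term,
        ← circleCoord_inj, ← hp]
      constructor
      · rintro ⟨h3, h4⟩
        exact eq_finish_of_mem_next q (circleCoord_mem y) h3 h4
      · intro e
        rw [e]
        refine ⟨?_, ?_⟩
        · simp only [CycIcc]
          grind
        · rw [start_next]
          simp only [CycIcc]
          grind

open Finset Classical in
theorem le_nestedCount : 3 * (r * r) ≤ 2 * nestedCount (family r) + 3 * r := by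
  have h1 := two_mul_card_lt r
  have h2 : #((univ : Finset (Fin 3)) ×ˢ ({q : Fin r × Fin r | q.1 < q.2} : Finset _)) ≤
      nestedCount (family r) := by
    refine card_le_card_of_injOn
      (fun u => (familyEquiv (u.1, u.2.1), familyEquiv (u.1, u.2.2))) ?_ ?_
    · rintro ⟨k, i, j⟩ hu
      have hij : i < j := by simpa using hu
      simp only [coe_filter, mem_univ, true_and, Set.mem_ofPred_eq]
      change CycNested (circleCoord (arc (k, i)).init) (circleCoord (arc (k, i)).term)
        (circleCoord (arc (k, j)).init) (circleCoord (arc (k, j)).term)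
      rw [circleCoord_init, circleCoord_term, circleCoord_init, circleCoord_term]
      exact nested k hij
    · rintro ⟨k, i, j⟩ _ ⟨k', i', j'⟩ _ e
      simp only [Prod.mk.injEq, EmbeddingLike.apply_eq_iff_eq] at e ⊢
      tauto
  rw [card_product, card_univ, Fintype.card_fin] at h2
  omega

theorem diskArea_family_le : diskArea (family r) ≤ 3 * r ^ 2 / 2 := by
  have h1 : (3 * (r * r) : ℝ) ≤ 2 * nestedCount (family r) + 3 * r := by
    exact_mod_cast le_nestedCount
  rw [isDiskFamily.diskArea_eq, card_family]
  push_cast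
  nlinarith

end

end TriangularDisk

/-- **Key counting step in the proof of Theorem 9.1 of the paper**: an area-minimal
`r`-disk family consists of at least `3r` arcs. -/
theorem card_ge_three_r (r : ℕ) (hr : 0 < r) {c : ℝ}
    (I : Finset (Arc c)) (hI : IsAreaMinimal r I) :
    3 * r ≤ I.card := by
  obtain ⟨hdisk, hmin⟩ := hI
  have hr' : (0 : ℝ) < r := by exact_mod_cast hr
  have : Fact (0 < c) := ⟨hdisk.1⟩
  have : Fact ((0 : ℝ) < 3 * r) := ⟨by linarith⟩
  have h1 := (hmin _ _ TriangularDisk.isDiskFamily).trans TriangularDisk.diskArea_family_le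
  rw [hdisk.diskArea_eq] at h1
  have h2 : (2 * nestedCount I + 2 * (I.card * r) + I.card : ℝ) ≤ I.card * I.card := by
    exact_mod_cast hdisk.nestedCount_le
  have h3 : (0 : ℝ) < I.card := by exact_mod_cast hdisk.card_pos hr
  have h4 : (0 : ℝ) ≤ nestedCount I := by positivity
  have h5 : (2 * r : ℝ) < I.card := by nlinarith
  have h6 : (3 * r : ℝ) ≤ I.card := by
    by_contra hlt
    nlinarith
  exact_mod_cast h6
end
end
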